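/- arXiv:1108.4751 — 10 statements merged into one kernel-verified Lean document; each statement's English description precedes it below -/
import Mathlib

section
/- For every finite simple graph G with at least one edge, the 2-tone chromatic number satisfies τ₂(G) ≤ ⌈(2 + √2)·Δ(G)⌉. -/
/-- A `t`-tone `k`-coloring of a simple graph `G` assigns to each vertex a `t`-element
subset of `{1, …, k}` so that any two distinct vertices `u`, `v` share fewer than
`d(u,v)` colors (vertices at infinite distance impose no constraint). -/
def IsTToneColoring {V : Type*} (G : SimpleGraph V) (t k : ℕ) (f : V → Finset ℕ) : Prop :=
  (∀ v, (f v).card = t ∧ f v ⊆ Finset.Icc 1 k) ∧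
  ∀ u v : V, u ≠ v → ((f u ∩ f v).card : ℕ∞) < G.edist u v

/-- The `t`-tone chromatic number: the least `k` admitting a `t`-tone `k`-coloring. -/
noncomputable def toneNumber {V : Type*} (G : SimpleGraph V) (t : ℕ) : ℕ :=
  sInf {k | ∃ f : V → Finset ℕ, IsTToneColoring G t k f}

lemma edist_gt_two_aux {V : Type*} (G : SimpleGraph V) (a u : V) (hne : u ≠ a)
    (hadj : ¬ G.Adj a u) (h2 : ∀ w, G.Adj a w → ¬ G.Adj w u) : (2 : ℕ∞) < G.edist a u := by
  by_contra hc
  rw [not_lt] at hc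
  have hr : G.edist a u ≠ ⊤ := by
    intro h
    rw [h] at hc
    exact absurd hc (by decide)
  obtain ⟨p, hp⟩ := (SimpleGraph.edist_ne_top_iff_reachable.mp hr).exists_walk_length_eq_edist
  rw [← hp] at hc
  have hc' : p.length ≤ 2 := by exact_mod_cast hc
  match p, hc' with
  | .nil, _ => exact hne rfl
  | .cons h .nil, _ => exact hadj h
  | .cons h (.cons h' .nil), _ => exact h2 _ h h'
  | .cons h (.cons h' (.cons h'' q)), hl => simp at hl

lemma edist_gt_one_aux {V : Type*} (G : SimpleGraph V) (a u : V) (hne : u ≠ a)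
    (hadj : ¬ G.Adj a u) : (1 : ℕ∞) < G.edist a u := by
  by_contra hc
  rw [not_lt] at hc
  rcases Order.le_one_iff.mp hc with h | h
  · exact hne (SimpleGraph.edist_eq_zero_iff.mp h).symm
  · exact hadj (SimpleGraph.edist_eq_one_iff_adj.mp h)

open Finset in
lemma greedy_aux {V : Type*} [Fintype V] [DecidableEq V] (G : SimpleGraph V) [DecidableRel G.Adj]
    (k : ℕ) (hk : 2 ≤ k)
    (hch : G.maxDegree * (G.maxDegree - 1) < (k - 2 * G.maxDegree).choose 2) (S : Finset V) :
    ∃ f : V → Finset ℕ, (∀ v, (f v).card = 2 ∧ f v ⊆ Finset.Icc 1 k) ∧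
      ∀ u ∈ S, ∀ v ∈ S, u ≠ v → ((f u ∩ f v).card : ℕ∞) < G.edist u v := by
  induction S using Finset.induction_on with
  | empty =>
    refine ⟨fun _ => {1, 2}, fun v => ⟨rfl, ?_⟩, by simp⟩
    intro x hx
    simp at hx
    simp
    omega
  | insert a S ha ih =>
    obtain ⟨f, hf, hS⟩ := ih
    set N := G.neighborFinset a with hN
    set used := N.biUnion f with hused
    have hNc : N.card ≤ G.maxDegree := by
      rw [hN, G.card_neighborFinset_eq_degree]; exact G.degree_le_maxDegree a
    have husedc : used.card ≤ 2 * G.maxDegree := by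
      have := card_biUnion_le_card_mul N f 2 (fun v _ => (hf v).1.le)
      calc used.card ≤ N.card * 2 := this
        _ ≤ _ := by omega
    set free := Icc 1 k \ used with hfree
    have hfreec : k - 2 * G.maxDegree ≤ free.card := by
      have := le_card_sdiff used (Icc 1 k)
      rw [Nat.card_Icc, ← hfree] at this
      omega
    set D := N.biUnion (fun w => (G.neighborFinset w).erase a) with hD
    have hDc : D.card ≤ G.maxDegree * (G.maxDegree - 1) := by
      refine (card_biUnion_le_card_mul N _ (G.maxDegree - 1) ?_).trans
        (Nat.mul_le_mul_right _ hNc)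
      intro w hw
      have hw' : G.Adj a w := by simpa [hN] using hw
      rw [card_erase_of_mem (by simpa using hw'.symm), G.card_neighborFinset_eq_degree]
      exact Nat.sub_le_sub_right (G.degree_le_maxDegree w) 1
    have hlt : (D.image f).card < (powersetCard 2 free).card := by
      rw [card_powersetCard]
      exact (card_image_le.trans hDc).trans_lt (hch.trans_le (Nat.choose_le_choose 2 hfreec))
    obtain ⟨p, hp, hpD⟩ := exists_mem_notMem_of_card_lt_card hlt
    rw [mem_powersetCard] at hp
    have key : ∀ u ∈ S, u ≠ a → ((p ∩ f u).card : ℕ∞) < G.edist a u := by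
      intro u _ hua
      by_cases hadj : G.Adj a u
      · have : p ∩ f u = ∅ := by
          rw [← disjoint_iff_inter_eq_empty]
          refine (disjoint_of_subset_left hp.1 ?_)
          refine disjoint_of_subset_right ?_ (sdiff_disjoint : Disjoint (Icc 1 k \ used) used)
          exact subset_biUnion_of_mem f (by simpa [hN] using hadj)
        rw [this]
        simpa using SimpleGraph.edist_pos_of_ne hua.symm
      · by_cases hu : u ∈ D
        · have hne : p ≠ f u := fun h => hpD (mem_image.mpr ⟨u, hu, h.symm⟩)
          refine lt_of_le_of_lt ?_ (edist_gt_one_aux G a u hua hadj)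
          have : (p ∩ f u).card ≤ 1 := by
            by_contra hc
            have h1 : p ∩ f u = p := eq_of_subset_of_card_le inter_subset_left (by omega)
            have h2 : p ∩ f u = f u :=
              eq_of_subset_of_card_le inter_subset_right (by rw [(hf u).1]; omega)
            exact hne (h1.symm.trans h2)
          exact_mod_cast this
        · refine lt_of_le_of_lt ?_ (edist_gt_two_aux G a u hua hadj ?_)
          · have : (p ∩ f u).card ≤ 2 := (card_le_card inter_subset_left).trans hp.2.le
            exact_mod_cast this
          · intro w h1 h2
            apply hu
            rw [hD, mem_biUnion]
            exact ⟨w, by simpa [hN] using h1, by simpa [hua] using h2⟩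
    refine ⟨Function.update f a p, ?_, ?_⟩
    · intro v
      by_cases hv : v = a
      · subst hv
        rw [Function.update_self]
        exact ⟨hp.2, hp.1.trans sdiff_subset⟩
      · rw [Function.update_of_ne hv]; exact hf v
    · intro u hu v hv huv
      rw [mem_insert] at hu hv
      by_cases hua : u = a
      · subst hua
        rw [Function.update_self, Function.update_of_ne huv.symm]
        exact key v (hv.resolve_left huv.symm) huv.symm
      · have huS := hu.resolve_left hua
        rw [Function.update_of_ne hua]
        by_cases hva : v = a
        · subst hva
          rw [Function.update_self, inter_comm, SimpleGraph.edist_comm]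
          exact key u huS hua
        · rw [Function.update_of_ne hva]
          exact hS u huS v (hv.resolve_left hva) huv

lemma arith_aux (d m : ℕ) (hd : 1 ≤ d) (hm : Real.sqrt 2 * d ≤ m) :
    d * (d - 1) < m.choose 2 := by
  have hs : Real.sqrt 2 ^ 2 = 2 := Real.sq_sqrt (by norm_num)
  have hs1 : 1 < Real.sqrt 2 := by
    rw [Real.lt_sqrt] <;> norm_num
  have hs2 : Real.sqrt 2 < 2 := by nlinarith
  obtain ⟨e, rfl⟩ : ∃ e, d = e + 1 := ⟨d - 1, by omega⟩
  have hd' : (0 : ℝ) < ((e + 1 : ℕ) : ℝ) := by positivity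
  have h1 : ((e + 1 : ℕ) : ℝ) * ((e + 1 : ℕ) - 1 : ℝ) < (m * (m - 1) / 2 : ℝ) := by
    have hD1 : (1 : ℝ) ≤ ((e + 1 : ℕ) : ℝ) := by exact_mod_cast hd
    generalize ((e + 1 : ℕ) : ℝ) = x at *
    have h3 : Real.sqrt 2 * x * (Real.sqrt 2 * x - 1) ≤ m * ((m : ℝ) - 1) := by
      apply mul_le_mul hm (by linarith) (by nlinarith) (by positivity)
    have h4 : Real.sqrt 2 * x * (Real.sqrt 2 * x - 1) = 2 * x ^ 2 - Real.sqrt 2 * x := by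
      linear_combination x ^ 2 * hs
    have h5 : 0 < (2 - Real.sqrt 2) * x := mul_pos (by linarith) hd'
    linarith [h3, h4, h5]
  rw [← Nat.cast_choose_two ℝ] at h1
  rw [Nat.add_sub_cancel]
  push_cast at h1
  rw [add_sub_cancel_right] at h1
  exact_mod_cast h1

theorem twoTone_le_ceil_two_add_sqrt_two_mul_maxDegree
    {V : Type*} [Fintype V] (G : SimpleGraph V) [DecidableRel G.Adj]
    (hedge : ∃ u v : V, G.Adj u v) :
    toneNumber G 2 ≤ ⌈(2 + Real.sqrt 2) * (G.maxDegree : ℝ)⌉₊ := by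
  classical
  obtain ⟨u, v, huv⟩ := hedge
  have hd : 1 ≤ G.maxDegree :=
    le_trans ((G.degree_pos_iff_exists_adj u).mpr ⟨v, huv⟩) (G.degree_le_maxDegree u)
  set k := ⌈(2 + Real.sqrt 2) * (G.maxDegree : ℝ)⌉₊ with hkdef
  have hk : (2 + Real.sqrt 2) * (G.maxDegree : ℝ) ≤ k := Nat.le_ceil _
  have hk2 : 2 * G.maxDegree ≤ k := by
    have : (2 * G.maxDegree : ℝ) ≤ k := by
      have := mul_nonneg (Real.sqrt_nonneg 2) (Nat.cast_nonneg (α := ℝ) G.maxDegree)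
      linarith
    exact_mod_cast this
  have hm : Real.sqrt 2 * G.maxDegree ≤ ((k - 2 * G.maxDegree : ℕ) : ℝ) := by
    rw [Nat.cast_sub hk2]; push_cast; linarith
  obtain ⟨f, hf, hS⟩ := greedy_aux G k (by omega) (arith_aux _ _ hd hm) Finset.univ
  exact Nat.sInf_le ⟨f, hf, fun u v h => hS u (by simp) v (by simp) h⟩
end

section
/- For every finite simple bipartite graph G with at least one edge, the 2-tone chromatic number satisfies τ₂(G) ≤ 2·⌈√2·Δ(G)⌉. -/
theorem greedy_aux_s1 {V α : Type*} [Fintype V] [Fintype α] [Nonempty α]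
    (R : V → V → Prop) (hs : ∀ u v, R u v → R v u) (hirr : ∀ v, ¬ R v v) (N : V → Finset V)
    (hN : ∀ u v, R v u → u ∈ N v) (hc : ∀ v, (N v).card < Fintype.card α) :
    ∃ c : V → α, ∀ u v, R u v → c u ≠ c v := by
  classical
  have key : ∀ S : Finset V, ∃ c : V → α, ∀ u ∈ S, ∀ v ∈ S, R u v → c u ≠ c v := by
    intro S
    induction S using Finset.induction_on with
    | empty => exact ⟨fun _ => Classical.arbitrary α, by simp⟩
    | insert a S ha ih =>
      obtain ⟨c, hcS⟩ := ih
      have : ∃ x : α, x ∉ (N a).image c := by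
        by_contra! h
        have h1 : (Finset.univ : Finset α) ⊆ (N a).image c := fun x _ => h x
        have h2 := Finset.card_le_card h1
        have h3 := Finset.card_image_le (s := N a) (f := c)
        have h4 := hc a
        rw [Finset.card_univ] at h2
        omega
      obtain ⟨x, hx⟩ := this
      have hx' : ∀ u, R a u → c u ≠ x := by
        intro u hu he
        exact hx (Finset.mem_image.2 ⟨u, hN u a hu, he⟩)
      refine ⟨Function.update c a x, ?_⟩
      intro u hu v hv huv
      by_cases h1 : u = a
      · subst h1
        by_cases h2 : v = u
        · subst h2; exact absurd huv (hirr _)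
        · rw [Function.update_self, Function.update_of_ne h2]
          exact (hx' v huv).symm
      · by_cases h2 : v = a
        · subst h2
          rw [Function.update_self, Function.update_of_ne h1]
          exact hx' u (hs _ _ huv)
        · rw [Function.update_of_ne h1, Function.update_of_ne h2]
          exact hcS u (Finset.mem_of_mem_insert_of_ne hu h1) v
            (Finset.mem_of_mem_insert_of_ne hv h2) huv
  obtain ⟨c, h⟩ := key Finset.univ
  exact ⟨c, fun u v => h u (Finset.mem_univ _) v (Finset.mem_univ _)⟩

theorem num_aux (d m : ℕ) (hd : 1 ≤ d) (h : Real.sqrt 2 * d ≤ m) :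
    d * (d - 1) < m.choose 2 := by
  obtain ⟨e, rfl⟩ : ∃ e, d = e + 1 := ⟨d - 1, by omega⟩
  have hs : Real.sqrt 2 ^ 2 = 2 := Real.sq_sqrt (by norm_num)
  have hs0 : 1 < Real.sqrt 2 := by
    rw [Real.lt_sqrt] <;> norm_num
  have hs2 : Real.sqrt 2 < 2 := by nlinarith
  have he : (0 : ℝ) ≤ e := Nat.cast_nonneg e
  have hlt : ((((e + 1) * (e + 1 - 1) : ℕ)) : ℝ) < (m.choose 2 : ℕ) := by
    rw [Nat.cast_choose_two]
    push_cast [Nat.add_sub_cancel] at h ⊢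
    have h1 : Real.sqrt 2 * (e + 1) * (Real.sqrt 2 * (e + 1) - 1) ≤ (m : ℝ) * (m - 1) := by
      apply mul_le_mul h (by linarith) (by nlinarith) (by linarith [Nat.cast_nonneg (α := ℝ) m])
    have h2 : Real.sqrt 2 * (e + 1) * (Real.sqrt 2 * (e + 1) - 1)
        = 2 * (e + 1 : ℝ) ^ 2 - Real.sqrt 2 * (e + 1) := by
      linear_combination ((e : ℝ) + 1) ^ 2 * hs
    have h3 : Real.sqrt 2 * ((e : ℝ) + 1) < 2 * (e + 1) :=
      mul_lt_mul_of_pos_right hs2 (by linarith)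
    nlinarith
  exact_mod_cast hlt

theorem twoTone_le_of_bipartite
    {V : Type*} [Fintype V] (G : SimpleGraph V) [DecidableRel G.Adj]
    (hbip : ∃ A : Set V, ∀ u v : V, G.Adj u v → (u ∈ A ↔ v ∉ A))
    (hedge : ∃ u v : V, G.Adj u v) :
    toneNumber G 2 ≤ 2 * ⌈Real.sqrt 2 * (G.maxDegree : ℝ)⌉₊ := by
  classical
  obtain ⟨A, hA⟩ := hbip
  obtain ⟨a, b, hab⟩ := hedge
  set m := ⌈Real.sqrt 2 * (G.maxDegree : ℝ)⌉₊ with hm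
  have hd : 1 ≤ G.maxDegree := by
    have h1 : 0 < G.degree a := (G.degree_pos_iff_exists_adj a).2 ⟨b, hab⟩
    have h2 := G.degree_le_maxDegree a
    omega
  have hnum := num_aux _ m hd (Nat.le_ceil _)
  have hα : Fintype.card (Finset.powersetCard 2 (Finset.Icc 1 m)) = m.choose 2 := by
    simp [Fintype.card_coe]
  have : Nonempty (Finset.powersetCard 2 (Finset.Icc 1 m)) := Fintype.card_pos_iff.1 (by omega)
  obtain ⟨c, hc⟩ := greedy_aux_s1 (α := Finset.powersetCard 2 (Finset.Icc 1 m)) (fun u v => u ≠ v ∧ ∃ w, G.Adj u w ∧ G.Adj w v)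
    (fun u v ⟨h, w, h1, h2⟩ => ⟨h.symm, w, h2.symm, h1.symm⟩) (fun v h => h.1 rfl)
    (fun v => (G.neighborFinset v).biUnion fun w => (G.neighborFinset w).erase v)
    (by
      rintro u v ⟨h, w, h1, h2⟩
      simp only [Finset.mem_biUnion, Finset.mem_erase, SimpleGraph.mem_neighborFinset]
      exact ⟨w, h1, h.symm, h2⟩)
    (by
      intro v
      rw [hα]
      refine lt_of_le_of_lt ?_ hnum
      refine (Finset.card_biUnion_le_card_mul _ _ (G.maxDegree - 1) ?_).trans
        (Nat.mul_le_mul_right _ (G.degree_le_maxDegree v))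
      intro w hw
      rw [Finset.card_erase_of_mem (by simpa using ((G.mem_neighborFinset _ _).1 hw).symm)]
      exact Nat.sub_le_sub_right (G.degree_le_maxDegree w) 1)
  have hcp : ∀ v, (c v).1 ⊆ Finset.Icc 1 m ∧ (c v).1.card = 2 := fun v =>
    Finset.mem_powersetCard.1 (c v).2
  let f : V → Finset ℕ := fun v => if v ∈ A then (c v).1 else (c v).1.map (addRightEmbedding m)
  have hcard : ∀ v, (f v).card = 2 := by
    intro v
    by_cases h : v ∈ A <;> simp [f, h, hcp]
  have hdisj : ∀ u v, u ∈ A → v ∉ A → f u ∩ f v = ∅ := by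
    intro u v hu hv
    ext x
    simp only [f, hu, hv, if_true, if_false, Finset.mem_inter, Finset.mem_map,
      addRightEmbedding_apply, Finset.notMem_empty, iff_false]
    rintro ⟨h1, y, h2, rfl⟩
    have h3 := Finset.mem_Icc.1 ((hcp u).1 h1)
    have h4 := Finset.mem_Icc.1 ((hcp v).1 h2)
    omega
  have hdisj' : ∀ u v, ¬ (u ∈ A ↔ v ∈ A) → f u ∩ f v = ∅ := by
    intro u v h
    by_cases hu : u ∈ A
    · exact hdisj u v hu (by tauto)
    · rw [Finset.inter_comm]; exact hdisj v u (by tauto) hu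
  apply Nat.sInf_le
  refine ⟨f, fun v => ⟨hcard v, ?_⟩, ?_⟩
  · intro x hx
    by_cases h : v ∈ A
    · simp only [f, h, if_true] at hx
      have h4 := Finset.mem_Icc.1 ((hcp v).1 hx)
      rw [Finset.mem_Icc]; omega
    · simp only [f, h, if_false, Finset.mem_map, addRightEmbedding_apply] at hx
      obtain ⟨y, hy, rfl⟩ := hx
      have h4 := Finset.mem_Icc.1 ((hcp v).1 hy)
      rw [Finset.mem_Icc]; omega
  · intro u v huv
    by_contra! hle
    have h2 : (f u ∩ f v).card ≤ 2 := (Finset.card_le_card Finset.inter_subset_left).trans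
      (hcard u).le
    have hne : G.edist u v ≠ ⊤ := ne_top_of_le_ne_top (ENat.coe_ne_top _) hle
    obtain ⟨p, hp⟩ := SimpleGraph.exists_walk_of_edist_ne_top hne
    rw [← hp] at hle
    have hle' : p.length ≤ (f u ∩ f v).card := by exact_mod_cast hle
    cases p with
    | nil => exact huv rfl
    | cons h1 q =>
      cases q with
      | nil =>
        have := hA _ _ h1
        rw [hdisj' u v (by tauto)] at hle'
        simp at hle'
      | cons h3 r =>
        cases r with
        | cons h4 s => simp only [SimpleGraph.Walk.length_cons] at hle'; omega
        | nil =>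
          simp only [SimpleGraph.Walk.length_cons, SimpleGraph.Walk.length_nil] at hle'
          have e1 := hA _ _ h1
          have e2 := hA _ _ h3
          have hcne := hc u v ⟨huv, _, h1, h3⟩
          have eu : f u ∩ f v = f u :=
            Finset.eq_of_subset_of_card_le Finset.inter_subset_left (by rw [hcard u]; omega)
          have ev : f u ∩ f v = f v :=
            Finset.eq_of_subset_of_card_le Finset.inter_subset_right (by rw [hcard v]; omega)
          have e : f u = f v := eu.symm.trans ev
          apply hcne
          by_cases hu : u ∈ A
          · have hv : v ∈ A := by tauto
            simp only [f, hu, hv, if_true] at e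
            exact Subtype.ext e
          · have hv : v ∉ A := by tauto
            simp only [f, hu, hv, if_false] at e
            exact Subtype.ext (Finset.map_injective _ e)
end

section
/- For every finite simple chordal graph G with at least one edge, the 2-tone chromatic number satisfies τ₂(G) ≤ ⌈(1 + √6/2)·Δ(G)⌉ + 1. -/
/-- A finite graph is chordal iff it has a simplicial elimination ordering: an ordering of
the vertices in which the later neighbors of each vertex form a clique. -/
def Chordal {V : Type*} (G : SimpleGraph V) : Prop :=
  ∃ σ : V → ℕ, Function.Injective σ ∧
    ∀ u v w : V, G.Adj u v → G.Adj u w → σ u < σ v → σ u < σ w → v ≠ w → G.Adj v w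

/-- Partial colouring of the vertices of rank at least `n`. -/
def PartialTone {V : Type*} (G : SimpleGraph V) (σ : V → ℕ) (k n : ℕ) (f : V → Finset ℕ) : Prop :=
  (∀ v, n ≤ σ v → (f v).card = 2 ∧ f v ⊆ Finset.Icc 1 k) ∧
  (∀ u v, n ≤ σ u → n ≤ σ v → G.Adj u v → Disjoint (f u) (f v)) ∧
  (∀ u v, n ≤ σ u → n ≤ σ v → u ≠ v → (∃ x, G.Adj u x ∧ G.Adj x v) → f u ≠ f v)

theorem count_ineq (D d k : ℕ) (hD : 1 ≤ D) (hd : d ≤ D)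
    (hk : (1 + Real.sqrt 6 / 2) * (D : ℝ) + 1 ≤ k) : d * (D - d) < (k - 2 * d).choose 2 := by
  have h6 : Real.sqrt 6 ^ 2 = 6 := Real.sq_sqrt (by norm_num)
  have h6' : 2 < Real.sqrt 6 := by
    apply Real.lt_sqrt_of_sq_lt; norm_num
  have hDr : (1:ℝ) ≤ D := by exact_mod_cast hD
  have hdr : (d:ℝ) ≤ D := by exact_mod_cast hd
  set s := Real.sqrt 6 with hs
  have hgap : (0:ℝ) < (1 + s / 2) * D - 2 * d := by nlinarith
  have hle : 2 * d + 1 ≤ k := by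
    have : ((2 * d + 1 : ℕ) : ℝ) ≤ k := by push_cast; linarith
    exact_mod_cast this
  obtain ⟨m, rfl⟩ := Nat.exists_eq_add_of_le hle
  have e : 2 * d + 1 + m - 2 * d = m + 1 := by omega
  obtain ⟨r, rfl⟩ := Nat.exists_eq_add_of_le hd
  rw [e, Nat.add_sub_cancel_left]
  push_cast at *
  have hm : (1 + s / 2) * (d + r) - 2 * d ≤ (m:ℝ) := by linarith
  have hmpos : (0:ℝ) < m := lt_of_lt_of_le hgap hm
  have hsq : ((1 + s / 2) * ((d:ℝ) + r) - 2 * d)^2 ≤ (m:ℝ)^2 := by gcongr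
  have key : 2 * ((d:ℝ) * r) ≤ ((1 + s / 2) * ((d:ℝ) + r) - 2 * d)^2 := by
    have : ((1 + s / 2) * ((d:ℝ) + r) - 2 * d)^2 - 2 * ((d:ℝ) * r)
        = 6 * (d - (3 + s) / 6 * (d + r))^2 + (s^2-6) * ((d+r)^2 * (1/4-1/6)) := by ring
    rw [h6] at this
    nlinarith [sq_nonneg ((d:ℝ) - (3 + s) / 6 * (d + r))]
  have hfin : 2 * (d * r) < (m + 1) * m := by
    have : ((2 * (d * r) : ℕ):ℝ) < (((m + 1) * m : ℕ):ℝ) := by push_cast; nlinarith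
    exact_mod_cast this
  have hdvd : 2 ∣ (m + 1) * m := by
    simpa using (Nat.even_mul_pred_self (m+1)).two_dvd
  rw [Nat.choose_two_right, Nat.add_sub_cancel, Nat.lt_div_iff_mul_lt' hdvd]
  omega

theorem partial_step {V : Type*} [Fintype V] (G : SimpleGraph V) [DecidableRel G.Adj]
    (σ : V → ℕ) (hinj : Function.Injective σ)
    (hσ : ∀ u v w : V, G.Adj u v → G.Adj u w → σ u < σ v → σ u < σ w → v ≠ w → G.Adj v w)
    (k : ℕ) (hk : ∀ d ≤ G.maxDegree, d * (G.maxDegree - d) < (k - 2 * d).choose 2)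
    (n : ℕ) (h : ∃ f, PartialTone G σ k (n+1) f) : ∃ f, PartialTone G σ k n f := by
  classical
  obtain ⟨f, h1, h2, h3⟩ := h
  by_cases hv : ∃ v, σ v = n
  swap
  · have hlt : ∀ v, n ≤ σ v → n + 1 ≤ σ v := fun v hn =>
      lt_of_le_of_ne hn (fun e => hv ⟨v, e.symm⟩)
    exact ⟨f, fun v a => h1 v (hlt v a), fun u v a b => h2 u v (hlt u a) (hlt v b),
      fun u v a b => h3 u v (hlt u a) (hlt v b)⟩
  obtain ⟨v, rfl⟩ := hv
  have hlt : ∀ w, w ≠ v → σ v ≤ σ w → σ v + 1 ≤ σ w := fun w hw hn =>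
      lt_of_le_of_ne hn (fun e => hw (hinj e.symm))
  set K : Finset V := (G.neighborFinset v).filter (fun u => σ v < σ u) with hK
  have memK : ∀ u, u ∈ K ↔ G.Adj v u ∧ σ v < σ u := by intro u; simp [hK]
  have hKd : K.card ≤ G.maxDegree :=
    (Finset.card_filter_le _ _).trans (G.degree_le_maxDegree v)
  set B := K.biUnion f with hB
  have hBc : B.card ≤ 2 * K.card := by
    rw [mul_comm]
    exact Finset.card_biUnion_le_card_mul _ _ _ (fun u hu => (h1 u ((memK u).1 hu).2).1.le)
  set W := K.biUnion (fun u => G.neighborFinset u \ insert v (K.erase u)) with hW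
  have hWc : W.card ≤ K.card * (G.maxDegree - K.card) := by
    refine Finset.card_biUnion_le_card_mul _ _ _ (fun u hu => ?_)
    have hsub : insert v (K.erase u) ⊆ G.neighborFinset u := by
      intro x hx
      rw [Finset.mem_insert, Finset.mem_erase] at hx
      rw [SimpleGraph.mem_neighborFinset]
      rcases hx with rfl | ⟨hx, hxK⟩
      · exact ((memK u).1 hu).1.symm
      · have a := (memK u).1 hu
        have b := (memK x).1 hxK
        exact hσ v u x a.1 b.1 a.2 b.2 (Ne.symm hx)
    have hc : (insert v (K.erase u)).card = K.card := by
      rw [Finset.card_insert_of_notMem, Finset.card_erase_add_one hu]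
      simp [memK]
    rw [Finset.card_sdiff_of_subset hsub, hc]
    exact Nat.sub_le_sub_right (G.degree_le_maxDegree u) _
  have hlt2 : (W.image f).card < ((Finset.Icc 1 k \ B).powersetCard 2).card := by
    rw [Finset.card_powersetCard]
    calc (W.image f).card ≤ W.card := Finset.card_image_le
      _ ≤ _ := hWc
      _ < (k - 2 * K.card).choose 2 := hk _ hKd
      _ ≤ _ := by
        apply Nat.choose_le_choose
        have := Finset.le_card_sdiff B (Finset.Icc 1 k)
        rw [Nat.card_Icc] at this
        omega
  obtain ⟨L, hL, hLW⟩ := Finset.exists_mem_notMem_of_card_lt_card hlt2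
  rw [Finset.mem_powersetCard] at hL
  obtain ⟨hLs, hLc⟩ := hL
  have hadj : ∀ u, σ v + 1 ≤ σ u → G.Adj v u → Disjoint L (f u) := by
    intro u hu ha
    rw [Finset.disjoint_left]
    intro x hx hxu
    exact (Finset.mem_sdiff.1 (hLs hx)).2
      (Finset.mem_biUnion.2 ⟨u, (memK u).2 ⟨ha, hu⟩, hxu⟩)
  have hdist : ∀ w, σ v + 1 ≤ σ w → (∃ x, G.Adj v x ∧ G.Adj x w) → L ≠ f w := by
    rintro w hw ⟨x, hvx, hxw⟩ e
    have hne : w ≠ v := by rintro rfl; omega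
    by_cases ha : G.Adj v w
    · have := hadj w hw ha
      rw [← e, disjoint_self] at this
      rw [this] at hLc
      simp at hLc
    by_cases hx : σ v < σ x
    · apply hLW
      rw [e]
      refine Finset.mem_image_of_mem f (Finset.mem_biUnion.2 ⟨x, (memK x).2 ⟨hvx, hx⟩, ?_⟩)
      rw [Finset.mem_sdiff, SimpleGraph.mem_neighborFinset, Finset.mem_insert, Finset.mem_erase, memK]
      exact ⟨hxw, by tauto⟩
    · have hx' : σ x < σ v := lt_of_le_of_ne (not_lt.1 hx) (fun e => hvx.ne (hinj e.symm))
      exact ha (hσ x v w hvx.symm hxw hx' (by omega) (Ne.symm hne))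
  refine ⟨Function.update f v L, ?_, ?_, ?_⟩
  · intro u hu
    by_cases e : u = v
    · subst e
      rw [Function.update_self]
      exact ⟨hLc, hLs.trans Finset.sdiff_subset⟩
    · rw [Function.update_of_ne e]
      exact h1 u (hlt u e hu)
  · intro u w hu hw ha
    by_cases e : u = v
    · subst e
      rw [Function.update_self, Function.update_of_ne ha.ne']
      exact hadj w (hlt w ha.ne' hw) ha
    · by_cases e' : w = v
      · subst e'
        rw [Function.update_self, Function.update_of_ne e]
        exact (hadj u (hlt u e hu) ha.symm).symm
      · rw [Function.update_of_ne e, Function.update_of_ne e']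
        exact h2 u w (hlt u e hu) (hlt w e' hw) ha
  · intro u w hu hw hne ha
    by_cases e : u = v
    · subst e
      rw [Function.update_self, Function.update_of_ne hne.symm]
      exact hdist w (hlt w hne.symm hw) ha
    · by_cases e' : w = v
      · subst e'
        rw [Function.update_self, Function.update_of_ne e]
        obtain ⟨x, a, b⟩ := ha
        exact (hdist u (hlt u e hu) ⟨x, b.symm, a.symm⟩).symm
      · rw [Function.update_of_ne e, Function.update_of_ne e']
        exact h3 u w (hlt u e hu) (hlt w e' hw) hne ha

theorem partial_all {V : Type*} [Fintype V] (G : SimpleGraph V) [DecidableRel G.Adj]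
    (σ : V → ℕ) (hinj : Function.Injective σ)
    (hσ : ∀ u v w : V, G.Adj u v → G.Adj u w → σ u < σ v → σ u < σ w → v ≠ w → G.Adj v w)
    (k : ℕ) (hk : ∀ d ≤ G.maxDegree, d * (G.maxDegree - d) < (k - 2 * d).choose 2) :
    ∃ f, PartialTone G σ k 0 f := by
  have base : ∃ n f, PartialTone G σ k n f := by
    have hb : ∀ v, σ v < Finset.univ.sup σ + 1 := fun v =>
      Nat.lt_succ_of_le (Finset.le_sup (f := σ) (Finset.mem_univ v))
    refine ⟨Finset.univ.sup σ + 1, fun _ => ∅, ?_, ?_, ?_⟩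
    · intro v hv
      exact absurd (hb v) (not_lt.2 hv)
    · intro u v hu
      exact absurd (hb u) (not_lt.2 hu)
    · intro u v hu
      exact absurd (hb u) (not_lt.2 hu)
  obtain ⟨n, hn⟩ := base
  induction n with
  | zero => exact hn
  | succ n ih => exact ih (partial_step G σ hinj hσ k hk n hn)

theorem twoTone_le_of_chordal
    {V : Type*} [Fintype V] (G : SimpleGraph V) [DecidableRel G.Adj]
    (hchordal : Chordal G) (hedge : ∃ u v : V, G.Adj u v) :
    toneNumber G 2 ≤ ⌈(1 + Real.sqrt 6 / 2) * (G.maxDegree : ℝ)⌉₊ + 1 := by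
  obtain ⟨σ, hinj, hσ⟩ := hchordal
  have hD : 1 ≤ G.maxDegree := by
    obtain ⟨u, v, h⟩ := hedge
    have : 0 < G.degree u := (G.degree_pos_iff_exists_adj u).2 ⟨v, h⟩
    exact this.trans_le (G.degree_le_maxDegree u)
  apply Nat.sInf_le
  obtain ⟨f, h1, h2, h3⟩ := partial_all G σ hinj hσ
    (⌈(1 + Real.sqrt 6 / 2) * (G.maxDegree : ℝ)⌉₊ + 1) (fun d hd => by
      apply count_ineq _ _ _ hD hd
      push_cast
      gcongr
      exact Nat.le_ceil _)
  refine ⟨f, fun v => h1 v (Nat.zero_le _), fun u v hne => ?_⟩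
  by_contra hcon
  rw [not_lt] at hcon
  have hfin : G.edist u v ≠ ⊤ := ne_top_of_le_ne_top (ENat.coe_ne_top _) hcon
  obtain ⟨p, hp⟩ := SimpleGraph.exists_walk_of_edist_ne_top hfin
  rw [← hp] at hcon
  have hcon : p.length ≤ (f u ∩ f v).card := by exact_mod_cast hcon
  have c2 := (h1 u (Nat.zero_le _)).1
  have c2' := (h1 v (Nat.zero_le _)).1
  have hle : (f u ∩ f v).card ≤ 2 := c2 ▸ Finset.card_le_card Finset.inter_subset_left
  match p, hcon with
  | .nil, _ => exact hne rfl
  | .cons h .nil, hc =>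
    have := h2 _ _ (Nat.zero_le _) (Nat.zero_le _) h
    rw [Finset.disjoint_iff_inter_eq_empty] at this
    rw [this] at hc
    simp at hc
  | .cons h (.cons h' .nil), hc =>
    have hc : 2 ≤ (f u ∩ f v).card := by simpa using hc
    apply h3 u v (Nat.zero_le _) (Nat.zero_le _) hne ⟨_, h, h'⟩
    have a := Finset.eq_of_subset_of_card_le (Finset.inter_subset_left : f u ∩ f v ⊆ f u) (by omega)
    have b := Finset.eq_of_subset_of_card_le (Finset.inter_subset_right : f u ∩ f v ⊆ f v) (by omega)
    exact a.symm.trans b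
  | .cons h (.cons h' (.cons h'' q)), hc =>
    simp only [SimpleGraph.Walk.length_cons] at hc
    omega
end

section
/- For every ε > 0 there exists r₀ such that every finite simple chordal graph G with maximum degree Δ(G) > r₀ satisfies τ₂(G) ≤ (2 + ε)·Δ(G). -/
open Finset

theorem lll_aux {V : Type*} [DecidableEq V]
    (Γ : V → Finset V) (D : ℕ) (hD : 1 ≤ D) (hΓ : ∀ v, (Γ v).card ≤ D) (p : ℝ) (hp : 0 ≤ p)
    (hpD : 4 * p * D ≤ 1) (N : Finset V → ℝ)
    (hN : ∀ S, 0 ≤ N S) (M : V → Finset V → ℝ)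
    (hMN : ∀ v S, N (insert v S) = N S - M v S)
    (hMmono : ∀ v S T, S ⊆ T → M v T ≤ M v S)
    (hM : ∀ v S, Disjoint S (Γ v) → M v S ≤ p * N S) :
    ∀ n, ∀ S : Finset V, S.card = n → ∀ v, (1 - 2 * p) * N S ≤ N (insert v S) := by
  have hD' : (1:ℝ) ≤ D := by exact_mod_cast hD
  have hp4 : p ≤ 1/4 := by nlinarith
  intro n
  induction n using Nat.strong_induction_on with
  | _ n ih =>
  intro S hS v
  -- add the elements of `T` one by one
  have key : ∀ T : Finset V, T ⊆ S ∩ Γ v →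
      (1 - 2 * p) ^ T.card * N (S \ Γ v) ≤ N (T ∪ (S \ Γ v)) := by
    intro T
    induction T using Finset.induction_on with
    | empty => intro _; simp
    | insert a T ha ihT =>
      intro hT
      have haS : a ∈ S ∩ Γ v := hT (mem_insert_self _ _)
      have hTS : T ⊆ S ∩ Γ v := fun x hx => hT (mem_insert_of_mem hx)
      have h1 := ihT hTS
      have hlt : (T ∪ (S \ Γ v)).card < n := by
        rw [← hS]
        apply Finset.card_lt_card
        refine ⟨?_, ?_⟩
        · intro x hx
          rcases mem_union.1 hx with h | h
          · exact (mem_inter.1 (hTS h)).1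
          · exact (mem_sdiff.1 h).1
        · intro h
          have := h (mem_inter.1 haS).1
          rcases mem_union.1 this with h | h
          · exact ha h
          · exact (mem_sdiff.1 h).2 (mem_inter.1 haS).2
      have h2 := ih _ hlt _ rfl a
      rw [card_insert_of_notMem ha, insert_union, pow_succ]
      nlinarith [mul_le_mul_of_nonneg_left h1 (by linarith : 0 ≤ 1 - 2 * p)]
  have h3 := key _ (Subset.refl _)
  have hU : (S ∩ Γ v) ∪ (S \ Γ v) = S := by
    ext x; simp only [mem_union, mem_inter, mem_sdiff]; tauto
  rw [hU] at h3
  have hc : ((S ∩ Γ v).card : ℝ) ≤ D := by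
    exact_mod_cast (card_le_card inter_subset_right).trans (hΓ v)
  have hb : 1 + ((S ∩ Γ v).card : ℝ) * (-(2 * p)) ≤ (1 + -(2*p)) ^ (S ∩ Γ v).card :=
    one_add_mul_le_pow (by linarith) _
  have hb2 : (1/2 : ℝ) ≤ (1 - 2 * p) ^ (S ∩ Γ v).card := by
    rw [← sub_eq_add_neg] at hb
    nlinarith [mul_le_mul_of_nonneg_left hc hp]
  have h4 : 1/2 * N (S \ Γ v) ≤ N S :=
    (mul_le_mul_of_nonneg_right hb2 (hN _)).trans h3
  have h5 := hMmono v (S \ Γ v) S sdiff_subset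
  have h6 := hM v (S \ Γ v) sdiff_disjoint
  rw [hMN]
  nlinarith

open Classical in
theorem lll {α V : Type*} [Fintype V] (Ω : Finset α) (hΩ : Ω.Nonempty) (E : V → α → Prop)
    (Γ : V → Finset V) (D : ℕ) (hD : 1 ≤ D) (hΓ : ∀ v, (Γ v).card ≤ D) (p : ℝ) (hp : 0 ≤ p)
    (hpD : 4 * p * D ≤ 1)
    (hM : ∀ v S, Disjoint S (Γ v) →
      ((Ω.filter (fun c => E v c ∧ ∀ u ∈ S, ¬ E u c)).card : ℝ) ≤
        p * ((Ω.filter (fun c => ∀ u ∈ S, ¬ E u c)).card : ℝ)) :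
    ∃ c ∈ Ω, ∀ v, ¬ E v c := by
  have hD' : (1:ℝ) ≤ D := by exact_mod_cast hD
  have hp4 : p ≤ 1/4 := by nlinarith
  set N : Finset V → ℝ := fun S => ((Ω.filter (fun c => ∀ u ∈ S, ¬ E u c)).card : ℝ) with hNdef
  have main := lll_aux Γ D hD hΓ p hp hpD N (fun S => Nat.cast_nonneg _)
    (fun v S => ((Ω.filter (fun c => E v c ∧ ∀ u ∈ S, ¬ E u c)).card : ℝ)) ?_ ?_ hM
  · have pos : ∀ S : Finset V, 0 < N S := by
      intro S
      induction S using Finset.induction_on with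
      | empty => simp [hNdef, hΩ]
      | insert a S ha ih =>
        have := main _ S rfl a
        have : 0 < (1 - 2 * p) * N S := mul_pos (by linarith) ih
        linarith
    have h := pos univ
    simp only [hNdef, Nat.cast_pos, card_pos] at h
    obtain ⟨c, hc⟩ := h
    rw [mem_filter] at hc
    exact ⟨c, hc.1, fun v => hc.2 v (mem_univ _)⟩
  · intro v S
    rw [eq_sub_iff_add_eq]
    simp only [hNdef]
    norm_cast
    rw [← card_union_of_disjoint]
    · congr 1
      ext c
      simp only [mem_union, mem_filter, mem_insert, forall_eq_or_imp]
      tauto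
    · rw [disjoint_left]
      intro c h1 h2
      simp only [mem_filter, mem_insert, forall_eq_or_imp] at h1 h2
      tauto
  · intro v S T hST
    norm_cast
    apply card_le_card
    intro c hc
    simp only [mem_filter] at hc ⊢
    exact ⟨hc.1, hc.2.1, fun u hu => hc.2.2 u (hST hu)⟩

open Classical in
theorem greedy {V : Type*} [Fintype V] (σ : V → ℕ) (hσ : Function.Injective σ)
    (P : V → Finset V) (hP : ∀ v, ∀ w ∈ P v, σ v < σ w) (m : ℕ) (hm : ∀ v, (P v).card < m) :
    ∃ f : V → Fin m, ∀ v, ∀ w ∈ P v, f v ≠ f w := by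
  by_cases hV : Nonempty V
  swap
  · exact ⟨fun v => (hV ⟨v⟩).elim, fun v => (hV ⟨v⟩).elim⟩
  have hm0 : 0 < m := lt_of_le_of_lt (Nat.zero_le _) (hm hV.some)
  have key : ∀ S : Finset V, ∃ f : V → Fin m, ∀ v ∈ S, ∀ w ∈ P v, w ∈ S → f v ≠ f w := by
    intro S
    induction S using Finset.induction_on_min_value σ with
    | empty => exact ⟨fun _ => ⟨0, hm0⟩, by simp⟩
    | insert a S ha hmin ih =>
      obtain ⟨f, hf⟩ := ih
      have : ((P a).image f).card < (univ : Finset (Fin m)).card := by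
        rw [card_univ, Fintype.card_fin]
        exact card_image_le.trans_lt (hm a)
      obtain ⟨b, _, hb⟩ := exists_mem_notMem_of_card_lt_card this
      refine ⟨Function.update f a b, ?_⟩
      intro v hv w hw hwS
      have hlt := hP v w hw
      rcases mem_insert.1 hv with rfl | hvS
      · have hne : w ≠ v := by rintro rfl; exact lt_irrefl _ hlt
        rw [Function.update_self, Function.update_of_ne hne]
        rintro rfl
        exact hb (mem_image_of_mem _ hw)
      · have hne : v ≠ a := by rintro rfl; exact ha hvS
        rcases mem_insert.1 hwS with rfl | hwS2
        · exact absurd (hmin v hvS) (by omega)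
        · have hne' : w ≠ a := by rintro rfl; exact ha hwS2
          rw [Function.update_of_ne hne, Function.update_of_ne hne']
          exact hf v hvS w hw hwS2
  obtain ⟨f, hf⟩ := key univ
  exact ⟨f, fun v w hw => hf v (mem_univ _) w hw (mem_univ _)⟩

open Classical in
noncomputable def bK {V : Type*} [Fintype V] (G : SimpleGraph V) (σ : V → ℕ) (v : V) : Finset V :=
  univ.filter (fun w => G.Adj v w ∧ σ v < σ w)

open Classical in
noncomputable def bW {V : Type*} [Fintype V] (G : SimpleGraph V) (σ : V → ℕ) (v : V) : Finset V :=
  univ.filter (fun w => σ v < σ w ∧ ¬ G.Adj v w ∧ ∃ y ∈ bK G σ v, G.Adj y w)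

def Dsc {V : Type*} (G : SimpleGraph V) (σ : V → ℕ) : V → V → Prop :=
  Relation.ReflTransGen (fun x y => G.Adj x y ∧ σ y < σ x)

def IsElim {V : Type*} (G : SimpleGraph V) (σ : V → ℕ) : Prop :=
  ∀ u v w : V, G.Adj u v → G.Adj u w → σ u < σ v → σ u < σ w → v ≠ w → G.Adj v w

def Proper {V : Type*} (G : SimpleGraph V) {m : ℕ} (c : V → Fin m) : Prop :=
  ∀ u v, G.Adj u v → c u ≠ c v

open Classical in
noncomputable def swapc {V : Type*} (G : SimpleGraph V) (σ : V → ℕ) {m : ℕ} (w : V) (a b : Fin m)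
    (c : V → Fin m) : V → Fin m :=
  fun u => if Dsc G σ w u then Equiv.swap a b (c u) else c u

section
variable {V : Type*} [Fintype V] {G : SimpleGraph V} {σ : V → ℕ}

theorem mem_bK {v w : V} : w ∈ bK G σ v ↔ G.Adj v w ∧ σ v < σ w := by simp [bK]

theorem mem_bW {v w : V} :
    w ∈ bW G σ v ↔ σ v < σ w ∧ ¬ G.Adj v w ∧ ∃ y ∈ bK G σ v, G.Adj y w := by simp [bW]

theorem dsc_le {w u : V} (h : Dsc G σ w u) : σ u ≤ σ w := by
  induction h with
  | refl => exact le_rfl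
  | tail _ h ih => exact h.2.le.trans ih

theorem dsc_boundary (hσ : Function.Injective σ) (hE : IsElim G σ) {w u : V} (h : Dsc G σ w u) :
    ∀ z, G.Adj z u → ¬ Dsc G σ w z → z ∈ bK G σ w := by
  induction h with
  | refl =>
    intro z hz hn
    rw [mem_bK]
    refine ⟨hz.symm, ?_⟩
    rcases lt_trichotomy (σ w) (σ z) with h | h | h
    · exact h
    · exact absurd (hσ h) hz.ne'
    · exact absurd (Relation.ReflTransGen.single ⟨hz.symm, h⟩) hn
  | @tail u' u h1 h2 ih =>
    intro z hz hn
    rcases lt_trichotomy (σ u) (σ z) with h | h | h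
    · by_cases hzu : z = u'
      · subst hzu; exact absurd h1 hn
      · exact ih z (hE u z u' hz.symm h2.1.symm h h2.2 hzu) hn
    · exact absurd (hσ h) hz.ne'
    · exact absurd (Relation.ReflTransGen.tail (Relation.ReflTransGen.tail h1 h2) ⟨hz.symm, h⟩) hn

theorem swapc_bK {m : ℕ} {w : V} {a b : Fin m} {c : V → Fin m} {y : V} (hy : y ∈ bK G σ w) :
    swapc G σ w a b c y = c y := by
  unfold swapc
  rw [if_neg]
  intro h
  have := dsc_le h
  have := (mem_bK.1 hy).2
  omega

theorem swapc_proper (hσ : Function.Injective σ) (hE : IsElim G σ) {m : ℕ} {w : V} {a b : Fin m}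
    {c : V → Fin m} (hc : Proper G c) (ha : ∀ y ∈ bK G σ w, c y ≠ a)
    (hb : ∀ y ∈ bK G σ w, c y ≠ b) : Proper G (swapc G σ w a b c) := by
  have cross : ∀ u v, G.Adj u v → Dsc G σ w u → ¬ Dsc G σ w v →
      Equiv.swap a b (c u) ≠ c v := by
    intro u v huv hu hv h
    have hK := dsc_boundary hσ hE hu v huv.symm hv
    have : Equiv.swap a b (c v) = c v := Equiv.swap_apply_of_ne_of_ne (ha v hK) (hb v hK)
    rw [← this] at h
    exact hc u v huv ((Equiv.swap a b).injective h)
  intro u v huv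
  unfold swapc
  by_cases hu : Dsc G σ w u <;> by_cases hv : Dsc G σ w v
  · rw [if_pos hu, if_pos hv]
    exact fun h => hc u v huv ((Equiv.swap a b).injective h)
  · rw [if_pos hu, if_neg hv]; exact cross u v huv hu hv
  · rw [if_neg hu, if_pos hv]; exact (cross v u huv.symm hv hu).symm
  · rw [if_neg hu, if_neg hv]; exact hc u v huv

theorem swapc_swapc {m : ℕ} {w : V} {a b : Fin m} {c : V → Fin m} :
    swapc G σ w a b (swapc G σ w a b c) = c := by
  funext u
  unfold swapc
  by_cases hu : Dsc G σ w u <;> simp [hu]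

open Classical in
theorem switch (hσ : Function.Injective σ) (hE : IsElim G σ) {m : ℕ} (w : V) (a : Fin m)
    (g : (V → Fin m) → ℝ) (hg : ∀ c, 0 ≤ g c)
    (hinv : ∀ b c, Proper G c → (∀ y ∈ bK G σ w, c y ≠ a) → (∀ y ∈ bK G σ w, c y ≠ b) →
      g (swapc G σ w a b c) = g c) :
    ((m : ℝ) - (bK G σ w).card) *
      ∑ c ∈ univ.filter (fun c : V → Fin m => Proper G c ∧ c w = a), g c ≤
      ∑ c ∈ univ.filter (fun c : V → Fin m => Proper G c), g c := by
  have h1 : ∀ b : Fin m,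
      ∑ c ∈ univ.filter (fun c : V → Fin m =>
        (Proper G c ∧ c w = a) ∧ ∀ y ∈ bK G σ w, c y ≠ b), g c ≤
      ∑ c ∈ univ.filter (fun c : V → Fin m => Proper G c ∧ c w = b), g c := by
    intro b
    have hca : ∀ c : V → Fin m, Proper G c → c w = a → ∀ y ∈ bK G σ w, c y ≠ a := by
      intro c hc hw y hy h
      exact hc w y (mem_bK.1 hy).1 (hw.trans h.symm)
    calc _ = ∑ c ∈ univ.filter (fun c : V → Fin m =>
        (Proper G c ∧ c w = a) ∧ ∀ y ∈ bK G σ w, c y ≠ b), g (swapc G σ w a b c) := by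
          apply sum_congr rfl
          intro c hc
          rw [mem_filter] at hc
          exact (hinv b c hc.2.1.1 (hca c hc.2.1.1 hc.2.1.2) hc.2.2).symm
      _ = ∑ c ∈ (univ.filter (fun c : V → Fin m =>
        (Proper G c ∧ c w = a) ∧ ∀ y ∈ bK G σ w, c y ≠ b)).image (swapc G σ w a b), g c := by
          rw [sum_image]
          intro c _ c' _ h
          have := congrArg (swapc G σ w a b) h
          rwa [swapc_swapc, swapc_swapc] at this
      _ ≤ _ := by
          apply sum_le_sum_of_subset_of_nonneg
          · intro c' hc'
            obtain ⟨c, hc, rfl⟩ := mem_image.1 hc'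
            rw [mem_filter] at hc
            rw [mem_filter]
            refine ⟨mem_univ _, swapc_proper hσ hE hc.2.1.1 (hca c hc.2.1.1 hc.2.1.2) hc.2.2, ?_⟩
            unfold swapc
            rw [if_pos (show Dsc G σ w w from Relation.ReflTransGen.refl), hc.2.1.2, Equiv.swap_apply_left]
          · intro c _ _; exact hg c
  have h2 : ∑ b : Fin m, ∑ c ∈ univ.filter (fun c : V → Fin m => Proper G c ∧ c w = b), g c =
      ∑ c ∈ univ.filter (fun c : V → Fin m => Proper G c), g c := by
    rw [← sum_fiberwise (univ.filter (fun c : V → Fin m => Proper G c)) (fun c => c w) g]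
    apply sum_congr rfl
    intro b _
    rw [filter_filter]
  rw [← h2]
  refine le_trans ?_ (sum_le_sum fun b _ => h1 b)
  simp only [← filter_filter (p := fun c : V → Fin m => Proper G c ∧ c w = a)]
  simp only [sum_filter (p := fun c : V → Fin m => ∀ y ∈ bK G σ w, c y ≠ _)]
  rw [sum_comm, mul_sum]
  apply sum_le_sum
  intro c _
  rw [← sum_filter, sum_const, nsmul_eq_mul]
  apply mul_le_mul_of_nonneg_right _ (hg c)
  have h3 : univ.filter (fun b : Fin m => ∀ y ∈ bK G σ w, c y ≠ b) =
      univ \ (bK G σ w).image c := by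
    ext b; simp
  have h4 : m ≤ (univ \ (bK G σ w).image c).card + (bK G σ w).card := by
    have := card_le_card_sdiff_add_card (s := (univ : Finset (Fin m))) (t := (bK G σ w).image c)
    rw [card_univ, Fintype.card_fin] at this
    have := card_image_le (s := bK G σ w) (f := c)
    omega
  rw [h3]
  have : (m : ℝ) ≤ ((univ \ (bK G σ w).image c).card : ℝ) + (bK G σ w).card := by exact_mod_cast h4
  linarith

open Classical in
/-- the bad event -/
def Bad (G : SimpleGraph V) (σ : V → ℕ) {m : ℕ} (T : V → ℝ) (v : V) (c : V → Fin m) : Prop :=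
  ∃ a, T v ≤ (((bW G σ v).filter (fun w => c w = a)).card : ℝ)

theorem bad_swapc_imp (hσ : Function.Injective σ) (hE : IsElim G σ) {m : ℕ} (T : V → ℝ)
    {u w : V} (hdis : Disjoint (bK G σ u) (bK G σ w)) {a b : Fin m} {c : V → Fin m}
    (ha : ∀ y ∈ bK G σ w, c y ≠ a)
    (hb : ∀ y ∈ bK G σ w, c y ≠ b) (h : Bad G σ T u c) : Bad G σ T u (swapc G σ w a b c) := by
  classical
  obtain ⟨e, he⟩ := h
  by_cases h1 : ∃ p ∈ bW G σ u, Dsc G σ w p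
  · -- all of bW u is in D ∪ K
    obtain ⟨p, hp, hpD⟩ := h1
    have hall : ∀ q ∈ bW G σ u, Dsc G σ w q ∨ q ∈ bK G σ w := by
      intro q hq
      by_contra hcon
      push Not at hcon
      obtain ⟨_, _, y, hy, hyp⟩ := mem_bW.1 hp
      obtain ⟨_, _, y', hy', hyq⟩ := mem_bW.1 hq
      have hyK : y ∉ bK G σ w := disjoint_left.1 hdis hy
      have hyK' : y' ∉ bK G σ w := disjoint_left.1 hdis hy'
      have hyD : Dsc G σ w y := by
        by_contra hn
        exact hyK (dsc_boundary hσ hE hpD y hyp hn)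
      have hyD' : Dsc G σ w y' := by
        by_contra hn
        by_cases hyy : y' = y
        · subst hyy; exact hn hyD
        · have hadj : G.Adj y' y := hE u y' y (mem_bK.1 hy').1 (mem_bK.1 hy).1 (mem_bK.1 hy').2
            (mem_bK.1 hy).2 hyy
          exact hyK' (dsc_boundary hσ hE hyD y' hadj hn)
      exact hcon.2 (dsc_boundary hσ hE hyD' q hyq.symm hcon.1)
    refine ⟨Equiv.swap a b e, ?_⟩
    convert he using 3
    apply filter_congr
    intro q hq
    have : swapc G σ w a b c q = Equiv.swap a b (c q) := by
      rcases hall q hq with h | h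
      · unfold swapc; rw [if_pos h]
      · rw [swapc_bK h, Equiv.swap_apply_of_ne_of_ne (ha q h) (hb q h)]
    rw [this]
    exact (Equiv.swap a b).injective.eq_iff
  · push Not at h1
    refine ⟨e, ?_⟩
    convert he using 3
    apply filter_congr
    intro q hq
    unfold swapc
    rw [if_neg (h1 q hq)]

theorem bad_swapc (hσ : Function.Injective σ) (hE : IsElim G σ) {m : ℕ} (T : V → ℝ)
    {u w : V} (hdis : Disjoint (bK G σ u) (bK G σ w)) {a b : Fin m} {c : V → Fin m}
    (ha : ∀ y ∈ bK G σ w, c y ≠ a)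
    (hb : ∀ y ∈ bK G σ w, c y ≠ b) : Bad G σ T u (swapc G σ w a b c) ↔ Bad G σ T u c := by
  constructor
  · intro h
    have := bad_swapc_imp hσ hE T hdis (a := a) (b := b) (c := swapc G σ w a b c)
      (fun y hy => by rw [swapc_bK hy]; exact ha y hy)
      (fun y hy => by rw [swapc_bK hy]; exact hb y hy) h
    rwa [swapc_swapc] at this
  · exact bad_swapc_imp hσ hE T hdis ha hb

open Classical in
/-- exponential moment -/
theorem moment (hσ : Function.Injective σ) (hE : IsElim G σ) {m : ℕ} (T : V → ℝ) (S : Finset V)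
    (a : Fin m) (s : ℝ) (hs : 0 ≤ s) (hm : ∀ w, (bK G σ w).card < m) (W : Finset V)
    (hW : ∀ w ∈ W, ∀ u ∈ S, Disjoint (bK G σ u) (bK G σ w)) :
    ∑ c ∈ univ.filter (fun c : V → Fin m => Proper G c),
      (if ∀ u ∈ S, ¬ Bad G σ T u c then (1:ℝ) else 0) *
        ∏ w ∈ W, (1 + s * if c w = a then 1 else 0) ≤
    (∏ w ∈ W, (1 + s / ((m:ℝ) - (bK G σ w).card))) *
      ∑ c ∈ univ.filter (fun c : V → Fin m => Proper G c),
        (if ∀ u ∈ S, ¬ Bad G σ T u c then (1:ℝ) else 0) := by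
  induction W using Finset.induction_on_min_value σ with
  | empty => simp
  | insert w W hw hmin ih =>
    have ih' := ih (fun w' hw' => hW w' (mem_insert_of_mem hw'))
    set g : (V → Fin m) → ℝ := fun c => (if ∀ u ∈ S, ¬ Bad G σ T u c then (1:ℝ) else 0) *
        ∏ w ∈ W, (1 + s * if c w = a then 1 else 0) with hgdef
    have hsw := switch hσ hE w a g ?_ ?_
    · have hpos : (0:ℝ) < (m:ℝ) - (bK G σ w).card := by
        have : ((bK G σ w).card : ℝ) < m := by exact_mod_cast hm w
        linarith
      rw [prod_insert hw, mul_assoc]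
      have hA : 0 ≤ 1 + s / ((m:ℝ) - (bK G σ w).card) := by positivity
      refine le_trans ?_ (mul_le_mul_of_nonneg_left ih' hA)
      have : ∀ c : V → Fin m, (if ∀ u ∈ S, ¬ Bad G σ T u c then (1:ℝ) else 0) *
        ∏ w ∈ insert w W, (1 + s * if c w = a then 1 else 0) = g c + s * if c w = a then g c else 0 := by
        intro c
        rw [prod_insert hw]
        simp only [hgdef]
        split_ifs <;> ring
      simp only [this]
      rw [sum_add_distrib, ← mul_sum, ← sum_filter, filter_filter, add_mul, one_mul]
      apply add_le_add le_rfl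
      rw [div_mul_eq_mul_div, mul_div_assoc]
      apply mul_le_mul_of_nonneg_left _ hs
      rw [le_div_iff₀ hpos, mul_comm]
      exact hsw
    · intro c
      simp only [hgdef]
      apply mul_nonneg
      · split_ifs <;> norm_num
      · apply prod_nonneg
        intro w _
        split_ifs <;> linarith
    · intro b c _ ha hb
      simp only [hgdef]
      congr 1
      · have : (∀ u ∈ S, ¬ Bad G σ T u (swapc G σ w a b c)) ↔ (∀ u ∈ S, ¬ Bad G σ T u c) := by
          apply forall₂_congr
          intro u hu
          rw [bad_swapc hσ hE T (hW w (mem_insert_self _ _) u hu) ha hb]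
        simp only [this]
      · apply prod_congr rfl
        intro w' hw'
        have : swapc G σ w a b c w' = c w' := by
          unfold swapc
          rw [if_neg]
          intro h
          have h1 := dsc_le h
          have h2 := hmin w' hw'
          have : w' = w := hσ (le_antisymm h1 h2)
          subst this
          exact hw hw'
        rw [this]

end

section
variable {V : Type*} [Fintype V] {G : SimpleGraph V} {σ : V → ℕ}

open Classical in
theorem near_card (Δ : ℕ) (hΔ : ∀ v, (univ.filter (G.Adj v)).card ≤ Δ) (v : V) :
    (univ.filter (fun u => ∃ w ∈ bW G σ v, ¬ Disjoint (bK G σ u) (bK G σ w))).card ≤ Δ ^ 4 := by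
  set N : V → Finset V := fun v => univ.filter (G.Adj v) with hN
  have h : univ.filter (fun u => ∃ w ∈ bW G σ v, ¬ Disjoint (bK G σ u) (bK G σ w)) ⊆
      (((N v).biUnion N).biUnion N).biUnion N := by
    intro u hu
    obtain ⟨w, hw, hd⟩ := (mem_filter.1 hu).2
    obtain ⟨_, _, y, hy, hyw⟩ := mem_bW.1 hw
    obtain ⟨z, hz1, hz2⟩ := not_disjoint_iff.1 hd
    simp only [mem_biUnion, hN, mem_filter, mem_univ, true_and]
    exact ⟨z, ⟨w, ⟨y, (mem_bK.1 hy).1, hyw⟩, (mem_bK.1 hz2).1⟩, (mem_bK.1 hz1).1.symm⟩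
  have h1 : ((N v).biUnion N).card ≤ Δ * Δ :=
    (card_biUnion_le_card_mul _ _ Δ (fun x _ => hΔ x)).trans (Nat.mul_le_mul_right _ (hΔ v))
  have h2 : (((N v).biUnion N).biUnion N).card ≤ Δ * Δ * Δ :=
    (card_biUnion_le_card_mul _ _ Δ (fun x _ => hΔ x)).trans (Nat.mul_le_mul_right _ h1)
  have h3 : ((((N v).biUnion N).biUnion N).biUnion N).card ≤ Δ * Δ * Δ * Δ :=
    (card_biUnion_le_card_mul _ _ Δ (fun x _ => hΔ x)).trans (Nat.mul_le_mul_right _ h2)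
  calc _ ≤ _ := card_le_card h
    _ ≤ _ := h3
    _ = Δ ^ 4 := by ring

open Classical in
theorem bK_card_le (Δ : ℕ) (hΔ : ∀ v, (univ.filter (G.Adj v)).card ≤ Δ) (v : V) :
    (bK G σ v).card ≤ Δ :=
  (card_le_card (fun w hw => by simpa using (mem_bK.1 hw).1)).trans (hΔ v)

open Classical in
theorem mu_bound (hσ : Function.Injective σ) (hE : IsElim G σ)
    (Δ : ℕ) (hΔ1 : 1 ≤ Δ) (hΔ : ∀ v, (univ.filter (G.Adj v)).card ≤ Δ) (η : ℝ) (hη : 0 < η)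
    (m : ℕ) (hm : (1 + η) * Δ ≤ m) (v : V) :
    ∑ w ∈ bW G σ v, 1 / ((m:ℝ) - (bK G σ w).card) ≤
      ((Δ : ℝ) - (bK G σ v).card) + 1 / η ^ 2 + 1 / η := by
  have hdK : ((bK G σ v).card : ℝ) ≤ Δ := by exact_mod_cast bK_card_le Δ hΔ v
  have hΔp : (1:ℝ) ≤ Δ := by exact_mod_cast hΔ1
  by_cases hne : (bK G σ v).Nonempty
  swap
  · have : bW G σ v = ∅ := by
      rw [eq_empty_iff_forall_notMem]
      intro w hw
      obtain ⟨_, _, y, hy, _⟩ := mem_bW.1 hw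
      exact hne ⟨y, hy⟩
    rw [this, sum_empty]
    have : 0 < 1 / η ^ 2 + 1 / η := by positivity
    linarith
  obtain ⟨y0, hy0, hmax⟩ := exists_max_image (bK G σ v) σ hne
  set K := bK G σ v with hK
  set d : ℝ := (K.card : ℝ) with hd
  have hd1 : 1 ≤ d := by
    rw [hd]; exact_mod_cast hne.card_pos
  set cnt : V → ℝ := fun w => ((K.filter (fun y => G.Adj y w)).card : ℝ) with hcnt
  have hηΔ : 0 < η * Δ := by positivity
  -- per-vertex degree bound
  have hout : ∀ y ∈ K, ∀ X : Finset V, (∀ w ∈ X, G.Adj y w ∧ w ≠ v ∧ w ∉ K) →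
      (X.card : ℝ) ≤ Δ - d := by
    intro y hy X hX
    have hsub : insert v (K.erase y ∪ X) ⊆ univ.filter (G.Adj y) := by
      intro z hz
      rw [mem_filter]
      refine ⟨mem_univ _, ?_⟩
      rcases mem_insert.1 hz with rfl | hz
      · exact (mem_bK.1 hy).1.symm
      · rcases mem_union.1 hz with hz | hz
        · obtain ⟨hzy, hzK⟩ := mem_erase.1 hz
          exact hE v y z (mem_bK.1 hy).1 (mem_bK.1 hzK).1 (mem_bK.1 hy).2 (mem_bK.1 hzK).2 hzy.symm
        · exact (hX z hz).1
    have hvK : v ∉ K := by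
      intro h; exact (mem_bK.1 h).1.ne rfl
    have hc : (insert v (K.erase y ∪ X)).card = K.card + X.card := by
      rw [card_insert_of_notMem, card_union_of_disjoint, card_erase_of_mem hy]
      · have := card_pos.2 ⟨y, hy⟩
        omega
      · rw [disjoint_left]
        intro z hz hz'
        exact (hX z hz').2.2 (mem_erase.1 hz).2
      · intro h
        rcases mem_union.1 h with h | h
        · exact hvK (mem_erase.1 h).2
        · exact (hX v h).2.1 rfl
    have := (card_le_card hsub).trans (hΔ y)
    rw [hc] at this
    have : ((K.card : ℝ) + X.card) ≤ Δ := by exact_mod_cast this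
    linarith
  have hWprop : ∀ w ∈ bW G σ v, w ≠ v ∧ w ∉ K := by
    intro w hw
    obtain ⟨h1, h2, _⟩ := mem_bW.1 hw
    refine ⟨?_, ?_⟩
    · rintro rfl; exact lt_irrefl _ h1
    · intro h; exact h2 (mem_bK.1 h).1
  have hsum : ∑ w ∈ bW G σ v, cnt w ≤ d * (Δ - d) := by
    have : ∑ w ∈ bW G σ v, cnt w = ∑ y ∈ K, (((bW G σ v).filter (fun w => G.Adj y w)).card : ℝ) := by
      simp only [hcnt]
      exact_mod_cast (sum_card_bipartiteAbove_eq_sum_card_bipartiteBelow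
        (s := K) (t := bW G σ v) (fun y w => G.Adj y w)).symm
    rw [this]
    calc _ ≤ ∑ y ∈ K, ((Δ:ℝ) - d) := by
          apply sum_le_sum
          intro y hy
          apply hout y hy
          intro w hw
          rw [mem_filter] at hw
          exact ⟨hw.2, hWprop w hw.1⟩
      _ = _ := by rw [sum_const, nsmul_eq_mul]
  have hpt : ∀ w ∈ bW G σ v, 1 / ((m:ℝ) - (bK G σ w).card) ≤
      cnt w * (1 / d) + cnt w * (1 / (η * Δ) ^ 2) + (if G.Adj y0 w then 1 / (η * Δ) else 0) := by
    intro w hw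
    have hdw : ((bK G σ w).card : ℝ) ≤ Δ := by exact_mod_cast bK_card_le Δ hΔ w
    have hcnt0 : 0 ≤ cnt w := Nat.cast_nonneg _
    have hbase : 1 / ((m:ℝ) - (bK G σ w).card) ≤ 1 / (η * Δ) := by
      apply one_div_le_one_div_of_le hηΔ
      linarith
    have hi0 : (0:ℝ) ≤ (if G.Adj y0 w then 1 / (η * Δ) else 0) := by
      split_ifs <;> positivity
    have ht1 : 0 ≤ cnt w * (1 / d) := by positivity
    have ht2 : 0 ≤ cnt w * (1 / (η * Δ) ^ 2) := by positivity
    by_cases hA : η * Δ ≤ cnt w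
    · have : 1 / (η * Δ) ≤ cnt w * (1 / (η * Δ) ^ 2) := by
        rw [mul_one_div, div_le_div_iff₀ hηΔ (by positivity)]
        nlinarith
      linarith
    push Not at hA
    by_cases hB : G.Adj y0 w
    · rw [if_pos hB]; linarith
    obtain ⟨hvw, hnadj, x, hx, hxw⟩ := mem_bW.1 hw
    have hcnt1 : 1 ≤ cnt w := by
      simp only [hcnt]
      exact_mod_cast card_pos.2 ⟨x, mem_filter.2 ⟨hx, hxw⟩⟩
    have hxlt : σ w < σ x := by
      rcases lt_trichotomy (σ w) (σ x) with h | h | h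
      · exact h
      · exact absurd (hσ h) hxw.ne'
      · exfalso
        by_cases hxy : y0 = x
        · subst hxy; exact hB hxw
        · have h1 : σ x < σ y0 := lt_of_le_of_ne (hmax x hx) (fun h => hxy (hσ h).symm)
          have h2 : G.Adj x y0 := hE v x y0 (mem_bK.1 hx).1 (mem_bK.1 hy0).1 (mem_bK.1 hx).2
            (mem_bK.1 hy0).2 (Ne.symm hxy)
          have hne' : y0 ≠ w := by
            rintro rfl; exact (hWprop _ hw).2 hy0
          exact hB (hE x y0 w h2 hxw h1 h hne')
    have hsplit : (bK G σ w).card ≤ (K.filter (fun y => G.Adj y w)).card +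
        ((bK G σ w).filter (fun z => z ∉ K)).card := by
      refine (card_le_card ?_).trans (card_union_le _ _)
      intro z hz
      rw [mem_union, mem_filter, mem_filter]
      by_cases hzK : z ∈ K
      · exact Or.inl ⟨hzK, (mem_bK.1 hz).1.symm⟩
      · exact Or.inr ⟨hz, hzK⟩
    have ho := hout x hx ((bK G σ w).filter (fun z => z ∉ K)) (by
      intro z hz
      rw [mem_filter] at hz
      refine ⟨?_, ?_, hz.2⟩
      · have hxz : x ≠ z := by rintro rfl; exact hz.2 hx
        exact hE w x z hxw.symm (mem_bK.1 hz.1).1 hxlt (mem_bK.1 hz.1).2 hxz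
      · rintro rfl
        have := (mem_bK.1 hz.1).2
        omega)
    have hsplit' : ((bK G σ w).card : ℝ) ≤ cnt w +
        (((bK G σ w).filter (fun z => z ∉ K)).card : ℝ) := by
      simp only [hcnt]; exact_mod_cast hsplit
    have : 1 / ((m:ℝ) - (bK G σ w).card) ≤ 1 / d := by
      apply one_div_le_one_div_of_le (by linarith)
      linarith
    have h3 : 1 / d ≤ cnt w * (1 / d) := le_mul_of_one_le_left (by positivity) hcnt1
    linarith
  calc _ ≤ _ := sum_le_sum hpt
    _ = (∑ w ∈ bW G σ v, cnt w) * (1 / d) + (∑ w ∈ bW G σ v, cnt w) * (1 / (η * Δ) ^ 2) +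
        ((bW G σ v).filter (fun w => G.Adj y0 w)).card * (1 / (η * Δ)) := by
          rw [sum_add_distrib, sum_add_distrib, ← sum_mul, ← sum_mul, ← sum_filter, sum_const,
            nsmul_eq_mul]
    _ ≤ (d * (Δ - d)) * (1 / d) + (Δ * Δ) * (1 / (η * Δ) ^ 2) + Δ * (1 / (η * Δ)) := by
          have h1 : (((bW G σ v).filter (fun w => G.Adj y0 w)).card : ℝ) ≤ Δ := by
            have : ((bW G σ v).filter (fun w => G.Adj y0 w)).card ≤ Δ :=
              (card_le_card (fun z hz => by
                rw [mem_filter] at hz ⊢; exact ⟨mem_univ _, hz.2⟩)).trans (hΔ y0)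
            exact_mod_cast this
          have h2 : d * (Δ - d) ≤ Δ * Δ := by nlinarith
          gcongr
          exact hsum.trans h2
    _ = _ := by
          field_simp

open Classical in
theorem prob_bound (hσ : Function.Injective σ) (hE : IsElim G σ)
    (Δ : ℕ) (hΔ1 : 1 ≤ Δ) (hΔ : ∀ v, (univ.filter (G.Adj v)).card ≤ Δ) (η : ℝ) (hη : 0 < η)
    (hη1 : η ≤ 1)
    (m : ℕ) (hm : (1 + η) * Δ ≤ m) (hm3 : (m:ℝ) ≤ 3 * Δ) (hbig : 1 / η ^ 2 + 1 / η ≤ η * Δ)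
    (T : V → ℝ) (hT : ∀ v, T v = Δ - (bK G σ v).card + 2 * η * Δ) (v : V) (S : Finset V)
    (hS : ∀ w ∈ bW G σ v, ∀ u ∈ S, Disjoint (bK G σ u) (bK G σ w)) :
    (((univ.filter (fun c : V → Fin m => Proper G c)).filter
      (fun c => Bad G σ T v c ∧ ∀ u ∈ S, ¬ Bad G σ T u c)).card : ℝ) ≤
    (3 * Δ * Real.exp (-(η ^ 2 / 8 * Δ))) *
    (((univ.filter (fun c : V → Fin m => Proper G c)).filter
      (fun c => ∀ u ∈ S, ¬ Bad G σ T u c)).card : ℝ) := by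
  have hΔp : (1:ℝ) ≤ Δ := by exact_mod_cast hΔ1
  have hηΔ : 0 < η * Δ := by positivity
  have hmK : ∀ w, (bK G σ w).card < m := by
    intro w
    have : ((bK G σ w).card : ℝ) ≤ Δ := by exact_mod_cast bK_card_le Δ hΔ w
    have : ((bK G σ w).card : ℝ) < m := by linarith
    exact_mod_cast this
  set Ω := univ.filter (fun c : V → Fin m => Proper G c) with hΩ
  set NN : ℝ := ((Ω.filter (fun c => ∀ u ∈ S, ¬ Bad G σ T u c)).card : ℝ) with hNN
  set θ : ℝ := η / 4 with hθ
  have hθ0 : 0 < θ := by positivity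
  have hs0 : 0 ≤ Real.exp θ - 1 := by
    have := Real.add_one_le_exp θ; linarith
  have hsle : Real.exp θ - 1 ≤ θ + θ ^ 2 := by
    have := Real.abs_exp_sub_one_sub_id_le (x := θ) (by rw [abs_of_pos hθ0]; linarith)
    have := (abs_le.1 this).2
    linarith
  have hper : ∀ a : Fin m, ((Ω.filter (fun c => (∀ u ∈ S, ¬ Bad G σ T u c) ∧
      T v ≤ (((bW G σ v).filter (fun w => c w = a)).card : ℝ))).card : ℝ) ≤
      Real.exp (-(η ^ 2 / 8 * Δ)) * NN := by
    intro a
    have hmom := moment hσ hE T S a (Real.exp θ - 1) hs0 hmK (bW G σ v) hS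
    have hprod : ∀ c : V → Fin m,
        ∏ w ∈ bW G σ v, (1 + (Real.exp θ - 1) * if c w = a then 1 else 0) =
        Real.exp (θ * (((bW G σ v).filter (fun w => c w = a)).card : ℝ)) := by
      intro c
      have : ∀ w, (1 + (Real.exp θ - 1) * if c w = a then 1 else 0) =
          if c w = a then Real.exp θ else 1 := by
        intro w; split_ifs <;> ring
      simp only [this]
      rw [← prod_filter, prod_const, ← Real.exp_nat_mul, mul_comm]
    simp only [hprod] at hmom
    have hN1 : ∑ c ∈ Ω, (if ∀ u ∈ S, ¬ Bad G σ T u c then (1:ℝ) else 0) = NN := by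
      rw [← sum_filter, sum_const, nsmul_eq_mul, mul_one]
    rw [hN1] at hmom
    have hNN0 : 0 ≤ NN := Nat.cast_nonneg _
    have hP : ∏ w ∈ bW G σ v, (1 + (Real.exp θ - 1) / ((m:ℝ) - (bK G σ w).card)) ≤
        Real.exp ((Real.exp θ - 1) * ∑ w ∈ bW G σ v, 1 / ((m:ℝ) - (bK G σ w).card)) := by
      rw [mul_sum, Real.exp_sum]
      apply prod_le_prod
      · intro w _
        have : ((bK G σ w).card : ℝ) < m := by exact_mod_cast hmK w
        have : 0 < (m:ℝ) - (bK G σ w).card := by linarith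
        positivity
      · intro w _
        rw [mul_one_div, add_comm]
        exact Real.add_one_le_exp _
    have hmu := mu_bound hσ hE Δ hΔ1 hΔ η hη m hm v
    have hlow : ((Ω.filter (fun c => (∀ u ∈ S, ¬ Bad G σ T u c) ∧
      T v ≤ (((bW G σ v).filter (fun w => c w = a)).card : ℝ))).card : ℝ) * Real.exp (θ * T v) ≤
      ∑ c ∈ Ω, (if ∀ u ∈ S, ¬ Bad G σ T u c then (1:ℝ) else 0) *
        Real.exp (θ * (((bW G σ v).filter (fun w => c w = a)).card : ℝ)) := by
      rw [← nsmul_eq_mul, ← sum_const, sum_filter]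
      apply sum_le_sum
      intro c _
      by_cases h1 : ∀ u ∈ S, ¬ Bad G σ T u c
      · by_cases h2 : T v ≤ (((bW G σ v).filter (fun w => c w = a)).card : ℝ)
        · rw [if_pos ⟨h1, h2⟩, if_pos h1, one_mul]
          apply Real.exp_le_exp.2
          exact mul_le_mul_of_nonneg_left h2 hθ0.le
        · rw [if_neg (fun h => h2 h.2), if_pos h1, one_mul]
          positivity
      · rw [if_neg (fun h => h1 h.1), if_neg h1, zero_mul]
    have hd0 : (0:ℝ) ≤ (bK G σ v).card := Nat.cast_nonneg _
    have hdΔ : ((bK G σ v).card : ℝ) ≤ Δ := by exact_mod_cast bK_card_le Δ hΔ v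
    have hexp : (Real.exp θ - 1) * ∑ w ∈ bW G σ v, 1 / ((m:ℝ) - (bK G σ w).card) ≤
        -(η ^ 2 / 8 * Δ) + θ * T v := by
      calc _ ≤ (Real.exp θ - 1) * (Δ - (bK G σ v).card + η * Δ) :=
            mul_le_mul_of_nonneg_left (by linarith) hs0
        _ ≤ (θ + θ ^ 2) * (Δ - (bK G σ v).card + η * Δ) :=
            mul_le_mul_of_nonneg_right hsle (by nlinarith)
        _ ≤ _ := by
            rw [hT, hθ]
            have : (Δ - (bK G σ v).card + η * Δ : ℝ) ≤ 2 * Δ := by nlinarith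
            have := mul_le_mul_of_nonneg_left this (sq_nonneg (η / 4))
            nlinarith
    have hfin : ((Ω.filter (fun c => (∀ u ∈ S, ¬ Bad G σ T u c) ∧
      T v ≤ (((bW G σ v).filter (fun w => c w = a)).card : ℝ))).card : ℝ) * Real.exp (θ * T v) ≤
      (Real.exp (-(η ^ 2 / 8 * Δ)) * NN) * Real.exp (θ * T v) := by
      refine hlow.trans (hmom.trans ?_)
      calc _ ≤ Real.exp (-(η ^ 2 / 8 * Δ) + θ * T v) * NN :=
            mul_le_mul_of_nonneg_right (hP.trans (Real.exp_le_exp.2 hexp)) hNN0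
        _ = _ := by rw [Real.exp_add]; ring
    exact le_of_mul_le_mul_right hfin (Real.exp_pos _)
  have hunion : (Ω.filter (fun c => Bad G σ T v c ∧ ∀ u ∈ S, ¬ Bad G σ T u c)) ⊆
      univ.biUnion (fun a : Fin m => Ω.filter (fun c => (∀ u ∈ S, ¬ Bad G σ T u c) ∧
      T v ≤ (((bW G σ v).filter (fun w => c w = a)).card : ℝ))) := by
    intro c hc
    rw [mem_filter] at hc
    obtain ⟨hc1, ⟨a, ha⟩, hc3⟩ := hc
    rw [mem_biUnion]
    exact ⟨a, mem_univ _, mem_filter.2 ⟨hc1, hc3, ha⟩⟩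
  have h1 := (card_le_card hunion).trans card_biUnion_le
  have h2 : ((Ω.filter (fun c => Bad G σ T v c ∧ ∀ u ∈ S, ¬ Bad G σ T u c)).card : ℝ) ≤
      ∑ a : Fin m, ((Ω.filter (fun c => (∀ u ∈ S, ¬ Bad G σ T u c) ∧
      T v ≤ (((bW G σ v).filter (fun w => c w = a)).card : ℝ))).card : ℝ) := by exact_mod_cast h1
  refine h2.trans ((sum_le_sum fun a _ => hper a).trans ?_)
  rw [sum_const, card_univ, Fintype.card_fin, nsmul_eq_mul, ← mul_assoc]
  gcongr

open Classical in
theorem exists_pair (hσ : Function.Injective σ) (hE : IsElim G σ)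
    (Δ : ℕ) (hΔ1 : 1 ≤ Δ) (hΔ : ∀ v, (univ.filter (G.Adj v)).card ≤ Δ) (η : ℝ) (hη : 0 < η)
    (hη1 : η ≤ 1)
    (m : ℕ) (hm : (1 + 2 * η) * Δ ≤ m) (hm3 : (m:ℝ) ≤ 3 * Δ) (hbig : 1 / η ^ 2 + 1 / η ≤ η * Δ)
    (hlll : 4 * (3 * Δ * Real.exp (-(η ^ 2 / 8 * Δ))) * (Δ:ℝ) ^ 4 ≤ 1) :
    ∃ c e : V → Fin m, (∀ u v, G.Adj u v → c u ≠ c v ∧ e u ≠ e v) ∧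
      (∀ u v y, u ≠ v → G.Adj u y → G.Adj y v → c u = c v → e u ≠ e v) := by
  have hΔp : (1:ℝ) ≤ Δ := by exact_mod_cast hΔ1
  have hηΔ : 0 < η * Δ := by positivity
  have hmK : ∀ w, (bK G σ w).card < m := by
    intro w
    have : ((bK G σ w).card : ℝ) ≤ Δ := by exact_mod_cast bK_card_le Δ hΔ w
    have : ((bK G σ w).card : ℝ) < m := by linarith
    exact_mod_cast this
  obtain ⟨c0, hc0⟩ := greedy σ hσ (bK G σ) (fun v w hw => (mem_bK.1 hw).2) m hmK
  have tot : ∀ f : V → Fin m, (∀ v, ∀ w ∈ bK G σ v, f v ≠ f w) → Proper G f := by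
    intro f hf u v huv
    rcases lt_trichotomy (σ u) (σ v) with h | h | h
    · exact hf u v (mem_bK.2 ⟨huv, h⟩)
    · exact absurd (hσ h) huv.ne
    · exact (hf v u (mem_bK.2 ⟨huv.symm, h⟩)).symm
  set T : V → ℝ := fun v => Δ - (bK G σ v).card + 2 * η * Δ with hT
  obtain ⟨c, hc, hgood⟩ := lll (univ.filter (fun c : V → Fin m => Proper G c))
    ⟨c0, mem_filter.2 ⟨mem_univ _, tot c0 hc0⟩⟩ (Bad G σ T)
    (fun v => univ.filter (fun u => ∃ w ∈ bW G σ v, ¬ Disjoint (bK G σ u) (bK G σ w)))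
    (Δ ^ 4) (Nat.one_le_pow _ _ hΔ1) (near_card Δ hΔ) (3 * Δ * Real.exp (-(η ^ 2 / 8 * Δ)))
    (by positivity) (by push_cast; exact hlll)
    (by
      intro v S hS
      apply prob_bound hσ hE Δ hΔ1 hΔ η hη hη1 m (by linarith) hm3 hbig T (fun _ => rfl) v S
      intro w hw u hu
      by_contra hcon
      exact disjoint_left.1 hS hu (mem_filter.2 ⟨mem_univ _, w, hw, hcon⟩))
  have hcp : Proper G c := (mem_filter.1 hc).2
  obtain ⟨e, he⟩ := greedy σ hσ (fun v => bK G σ v ∪ (bW G σ v).filter (fun w => c w = c v))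
    (by
      intro v w hw
      rcases mem_union.1 hw with h | h
      · exact (mem_bK.1 h).2
      · exact (mem_bW.1 (mem_filter.1 h).1).1) m
    (by
      intro v
      have h1 := hgood v
      unfold Bad at h1
      push Not at h1
      have h2 := h1 (c v)
      have h3 := card_union_le (bK G σ v) ((bW G σ v).filter (fun w => c w = c v))
      have h4 : ((bK G σ v ∪ (bW G σ v).filter (fun w => c w = c v)).card : ℝ) ≤
        (bK G σ v).card + (((bW G σ v).filter (fun w => c w = c v)).card : ℝ) := by
        exact_mod_cast h3
      have h5 : ((bK G σ v ∪ (bW G σ v).filter (fun w => c w = c v)).card : ℝ) < m := by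
        simp only [hT] at h2
        linarith
      exact_mod_cast h5)
  have hep : Proper G e := tot e (fun v w hw => he v w (mem_union_left _ hw))
  refine ⟨c, e, fun u v h => ⟨hcp u v h, hep u v h⟩, ?_⟩
  have half : ∀ u v y, σ u < σ v → G.Adj u y → G.Adj y v → c u = c v → e u ≠ e v := by
    intro u v y hlt huy hyv hcc
    by_cases hadj : G.Adj u v
    · exact hep u v hadj
    apply he u v
    apply mem_union_right
    rw [mem_filter]
    refine ⟨mem_bW.2 ⟨hlt, hadj, y, mem_bK.2 ⟨huy, ?_⟩, hyv⟩, hcc.symm⟩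
    rcases lt_trichotomy (σ u) (σ y) with h | h | h
    · exact h
    · exact absurd (hσ h) huy.ne
    · refine absurd (hE y u v huy.symm hyv h (h.trans hlt) ?_) hadj
      rintro rfl; exact lt_irrefl _ hlt
  intro u v y huv huy hyv hcc
  rcases lt_trichotomy (σ u) (σ v) with h | h | h
  · exact half u v y h huy hyv hcc
  · exact absurd (hσ h) huv
  · exact (half v u y h hyv.symm huy.symm hcc.symm).symm

theorem tone_of_pair {m : ℕ} (c e : V → Fin m) (h1 : ∀ u v, G.Adj u v → c u ≠ c v ∧ e u ≠ e v)
    (h2 : ∀ u v y, u ≠ v → G.Adj u y → G.Adj y v → c u = c v → e u ≠ e v) :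
    toneNumber G 2 ≤ 2 * m := by
  classical
  apply Nat.sInf_le
  refine ⟨fun v => {(c v : ℕ) + 1, m + (e v : ℕ) + 1}, ?_, ?_⟩
  · intro v
    have hc := (c v).isLt
    have he := (e v).isLt
    refine ⟨card_pair (by omega), ?_⟩
    intro x hx
    simp only [mem_insert, mem_singleton] at hx
    rw [mem_Icc]
    omega
  · intro u v huv
    have hmem : ∀ x, x ∈ ({(c u : ℕ) + 1, m + (e u : ℕ) + 1} ∩ {(c v : ℕ) + 1, m + (e v : ℕ) + 1} : Finset ℕ) ↔
        ((x = (c u : ℕ) + 1 ∧ c u = c v) ∨ (x = m + (e u : ℕ) + 1 ∧ e u = e v)) := by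
      intro x
      have hc := (c v).isLt
      have he := (e v).isLt
      have hc' := (c u).isLt
      have he' := (e u).isLt
      simp only [mem_inter, mem_insert, mem_singleton, Fin.ext_iff]
      omega
    by_cases hadj : G.Adj u v
    · have : ({(c u : ℕ) + 1, m + (e u : ℕ) + 1} ∩ {(c v : ℕ) + 1, m + (e v : ℕ) + 1} : Finset ℕ) = ∅ := by
        rw [eq_empty_iff_forall_notMem]
        intro x hx
        rcases (hmem x).1 hx with h | h
        · exact (h1 u v hadj).1 h.2
        · exact (h1 u v hadj).2 h.2
      simp only [this]
      simpa using SimpleGraph.edist_pos_of_ne huv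
    · by_contra hcon
      push Not at hcon
      have hfin : G.edist u v ≠ ⊤ := ne_top_of_le_ne_top (ENat.coe_ne_top _) hcon
      obtain ⟨p, hp⟩ := SimpleGraph.exists_walk_of_edist_ne_top hfin
      rw [← hp] at hcon
      have hcon' : p.length ≤ ({(c u : ℕ) + 1, m + (e u : ℕ) + 1} ∩ {(c v : ℕ) + 1, m + (e v : ℕ) + 1} : Finset ℕ).card := by
        exact_mod_cast hcon
      match p, hcon' with
      | .nil, _ => exact huv rfl
      | .cons h .nil, _ => exact hadj h
      | .cons (v := y) h (.cons h' .nil), hcard =>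
        simp only [SimpleGraph.Walk.length_cons, SimpleGraph.Walk.length_nil] at hcard
        have hne := h2 u v y huv h h'
        have : ({(c u : ℕ) + 1, m + (e u : ℕ) + 1} ∩ {(c v : ℕ) + 1, m + (e v : ℕ) + 1} : Finset ℕ).card ≤ 1 := by
          rw [card_le_one]
          intro x hx z hz
          rcases (hmem x).1 hx with h | h <;> rcases (hmem z).1 hz with h' | h'
          · rw [h.1, h'.1]
          · exact absurd h'.2 (hne h.2)
          · exact absurd h.2 (hne h'.2)
          · rw [h.1, h'.1]
        omega
      | .cons h (.cons h' (.cons h'' q)), hcard =>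
        simp only [SimpleGraph.Walk.length_cons] at hcard
        have : ({(c u : ℕ) + 1, m + (e u : ℕ) + 1} ∩ {(c v : ℕ) + 1, m + (e v : ℕ) + 1} : Finset ℕ).card ≤ 2 :=
          (card_le_card inter_subset_left).trans card_le_two
        omega

end

theorem exists_threshold (ε : ℝ) (hε : 0 < ε) (η : ℝ) (hη : 0 < η) :
    ∃ r₀ : ℕ, ∀ Δ : ℕ, r₀ < Δ → 1 / η ^ 2 + 1 / η ≤ η * Δ ∧ 2 ≤ ε / 2 * (Δ:ℝ) ∧ 1 ≤ η * (Δ:ℝ) ∧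
      4 * (3 * Δ * Real.exp (-(η ^ 2 / 8 * Δ))) * (Δ:ℝ) ^ 4 ≤ 1 := by
  have hb : 0 < η ^ 2 / 8 := by positivity
  have t0 : Filter.Tendsto (fun n : ℕ => (n:ℝ)) Filter.atTop Filter.atTop :=
    tendsto_natCast_atTop_atTop
  have t1 := t0.const_mul_atTop hη
  have t2 := t0.const_mul_atTop (half_pos hε)
  have t3 := (Real.tendsto_pow_mul_exp_neg_atTop_nhds_zero 5).comp (t0.const_mul_atTop hb)
  have hc : 0 < (η ^ 2 / 8) ^ 5 / 12 := by positivity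
  have ev := (t1.eventually_ge_atTop (1 / η ^ 2 + 1 / η)).and
    ((t2.eventually_ge_atTop 2).and ((t1.eventually_ge_atTop 1).and
      (t3.eventually (gt_mem_nhds hc))))
  obtain ⟨r, hr⟩ := Filter.eventually_atTop.1 ev
  refine ⟨r, fun Δ hΔ => ?_⟩
  obtain ⟨h1, h2, h3, h4⟩ := hr Δ hΔ.le
  refine ⟨h1, h2, h3, ?_⟩
  simp only [Function.comp] at h4
  rw [mul_pow, lt_div_iff₀ (by norm_num)] at h4
  have hb5 : 0 < (η ^ 2 / 8) ^ 5 := by positivity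
  have : (η ^ 2 / 8) ^ 5 * (4 * (3 * Δ * Real.exp (-(η ^ 2 / 8 * Δ))) * (Δ:ℝ) ^ 4) ≤
      (η ^ 2 / 8) ^ 5 * 1 := by
    calc _ = (η ^ 2 / 8) ^ 5 * (Δ:ℝ) ^ 5 * Real.exp (-(η ^ 2 / 8 * Δ)) * 12 := by ring
      _ ≤ _ := by rw [mul_one]; exact h4.le
  exact le_of_mul_le_mul_left this hb5

theorem twoTone_le_of_chordal_large_maxDegree :
    ∀ ε : ℝ, 0 < ε → ∃ r₀ : ℕ,
      ∀ (V : Type) [Fintype V] (G : SimpleGraph V) [DecidableRel G.Adj],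
        Chordal G → r₀ < G.maxDegree →
          (toneNumber G 2 : ℝ) ≤ (2 + ε) * (G.maxDegree : ℝ) := by
  intro ε hε
  set η : ℝ := min ε 1 / 8 with hη
  have hmin : 0 < min ε 1 := lt_min hε one_pos
  have hη0 : 0 < η := by positivity
  have hηε : η ≤ ε / 8 := by rw [hη]; linarith [min_le_left ε 1]
  have hη1 : η ≤ 1 / 8 := by rw [hη]; linarith [min_le_right ε 1]
  obtain ⟨r₀, hr⟩ := exists_threshold ε hε η hη0
  refine ⟨r₀, ?_⟩
  intro V _ G _ hch hlt
  obtain ⟨σ, hσ, hE⟩ := hch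
  obtain ⟨k1, k2, k3, k4⟩ := hr _ hlt
  set Δ := G.maxDegree with hΔdef
  have hΔ1 : 1 ≤ Δ := by omega
  have hΔp : (1:ℝ) ≤ Δ := by exact_mod_cast hΔ1
  have hdeg : ∀ v, (@Finset.filter V (G.Adj v) (fun a => Classical.propDecidable _) univ).card ≤ Δ := by
    intro v
    have := G.degree_le_maxDegree v
    rw [← G.card_neighborFinset_eq_degree, G.neighborFinset_eq_filter] at this
    convert this
  have hm1 : (1 + 2 * η) * Δ ≤ (⌈(1 + 2 * η) * (Δ:ℝ)⌉₊ : ℝ) := Nat.le_ceil _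
  have hm2 : (⌈(1 + 2 * η) * (Δ:ℝ)⌉₊ : ℝ) < (1 + 2 * η) * Δ + 1 := Nat.ceil_lt_add_one (by positivity)
  obtain ⟨c, e, h1, h2⟩ := exists_pair hσ hE Δ hΔ1 hdeg η hη0 (by linarith) _ hm1
    (by nlinarith) k1 k4
  have h3 := tone_of_pair c e h1 h2
  have h4 : (toneNumber G 2 : ℝ) ≤ 2 * (⌈(1 + 2 * η) * (Δ:ℝ)⌉₊ : ℝ) := by exact_mod_cast h3
  nlinarith
end

section
/- The Heawood graph has no 2-tone 6-coloring; that is, τ₂(Heawood) > 6. -/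
/-- The Heawood graph on vertex set `ℤ/14ℤ`: each `i` is adjacent to `i + 1` and `i - 1`,
and each even `i` is adjacent to `i + 5`. -/
def heawoodGraph : SimpleGraph (ZMod 14) :=
  SimpleGraph.fromRel (fun i j => j = i + 1 ∨ (Even i.val ∧ j = i + 5))

namespace HW

/-- Compatibility of labels `x`, `c` (bitmasks) of vertices `p - d` and `p`. -/
def chk (p d x c : ℕ) : Bool :=
  match Nat.beq (d % 2) 0 with
  | true => !(Nat.beq x c)
  | false =>
    match (Nat.beq d 1 || Nat.beq d 13 || (Nat.beq d 5 && Nat.beq (p % 2) 1) ||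
      (Nat.beq d 9 && Nat.beq (p % 2) 0)) with
    | true => Nat.beq (Nat.land x c) 0
    | false => true

def okL (p c : ℕ) : List ℕ → ℕ → Bool
  | [], _ => true
  | x :: l, d => chk p d x c && okL p c l (d + 1)

def labels : List ℕ := [3, 5, 9, 17, 33, 6, 10, 18, 34, 12, 20, 36, 24, 40, 48]

def noExt : ℕ → ℕ → List ℕ → Bool
  | 0, _, _ => false
  | n + 1, p, l => labels.all fun c => !(okL p c l 1) || noExt n (p + 1) (c :: l)

def pre (g : ℕ → ℕ) : ℕ → List ℕ
  | 0 => []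
  | n + 1 => g n :: pre g n

lemma okL_pre (g : ℕ → ℕ) (p : ℕ) (h : ∀ q < p, chk p (p - q) (g q) (g p) = true) :
    ∀ n d, n + d = p + 1 → 1 ≤ d → okL p (g p) (pre g n) d = true := by
  intro n
  induction n with
  | zero => intros; rfl
  | succ n ih =>
    intro d hd h1
    have := h n (by omega)
    rw [show p - n = d by omega] at this
    simp only [pre, okL, this, Bool.true_and]
    exact ih (d + 1) (by omega) (by omega)

lemma noExt_sound (g : ℕ → ℕ) (hl : ∀ p < 14, g p ∈ labels)
    (h : ∀ p < 14, ∀ q < p, chk p (p - q) (g q) (g p) = true) :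
    ∀ n p, n + p = 14 → noExt n p (pre g p) = false := by
  intro n
  induction n with
  | zero => intros; rfl
  | succ n ih =>
    intro p hp
    by_contra hc
    rw [Bool.not_eq_false, noExt, List.all_eq_true] at hc
    have h1 := hc (g p) (hl p (by omega))
    rw [okL_pre g p (h p (by omega)) p 1 (by omega) le_rfl] at h1
    have h2 := ih (p + 1) (by omega)
    simp only [pre] at h2
    rw [h2] at h1
    simp at h1

set_option maxRecDepth 100000 in
lemma search : noExt 12 2 [12, 3] = true := by decide +kernel

def mask (a b : Fin 6) : ℕ := 2 ^ a.val + 2 ^ b.val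

lemma mask_mem : ∀ a b : Fin 6, a ≠ b → mask a b ∈ labels := by decide +kernel

lemma mask_disj : ∀ a b c d : Fin 6, (a ≠ b ∧ c ≠ d ∧ a ≠ c ∧ a ≠ d ∧ b ≠ c ∧ b ≠ d) →
    Nat.beq (Nat.land (mask a b) (mask c d)) 0 = true := by decide +kernel

lemma mask_ne : ∀ a b c d : Fin 6, a ≠ b → c ≠ d → ¬ (a = c ∧ b = d) → ¬ (a = d ∧ b = c) →
    (!(Nat.beq (mask a b) (mask c d))) = true := by decide +kernel

/-- explicit adjacency -/
def A (i j : ZMod 14) : Prop :=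
  i ≠ j ∧ ((j = i + 1 ∨ (Even i.val ∧ j = i + 5)) ∨ (i = j + 1 ∨ (Even j.val ∧ i = j + 5)))

instance : DecidableRel A := fun i j => by unfold A; infer_instance

lemma chk_cases : ∀ p : Fin 14, ∀ q : Fin 14, q < p →
    let d := p.val - q.val
    (Nat.beq (d % 2) 0 = true ∧ ((q.val : ZMod 14) ≠ (p.val : ZMod 14)) ∧
      ∃ w, A (q.val : ZMod 14) w ∧ A w (p.val : ZMod 14)) ∨
    (Nat.beq (d % 2) 0 = false ∧ ((Nat.beq d 1 || Nat.beq d 13 ||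
      (Nat.beq d 5 && Nat.beq (p.val % 2) 1) || (Nat.beq d 9 && Nat.beq (p.val % 2) 0)) = true)
       ∧ A (q.val : ZMod 14) (p.val : ZMod 14)) ∨
    (Nat.beq (d % 2) 0 = false ∧ ((Nat.beq d 1 || Nat.beq d 13 ||
      (Nat.beq d 5 && Nat.beq (p.val % 2) 1) || (Nat.beq d 9 && Nat.beq (p.val % 2) 0)) = false)) := by
  decide +kernel

lemma core (a b : ZMod 14 → Fin 6) (h : ∀ v, a v ≠ b v)
    (hadj : ∀ u v, A u v → a u ≠ a v ∧ a u ≠ b v ∧ b u ≠ a v ∧ b u ≠ b v)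
    (hd : ∀ u v w, u ≠ v → A u w → A w v →
      ¬ (a u = a v ∧ b u = b v) ∧ ¬ (a u = b v ∧ b u = a v)) : False := by
  have h01 : A 0 1 := by decide +kernel
  obtain ⟨e1, e2, e3, e4⟩ := hadj _ _ h01
  have hx : Function.Injective ![a 0, b 0, a 1, b 1] := by
    have f1 := h 0
    have f2 := h 1
    intro i j hij
    clear h hadj hd
    fin_cases i <;> fin_cases j <;> simp at hij ⊢ <;> simp_all
  obtain ⟨σ, hσ⟩ : ∃ σ : Equiv.Perm (Fin 6), ∀ i : Fin 4,
      σ (![a 0, b 0, a 1, b 1] i) = (![0, 1, 2, 3] : Fin 4 → Fin 6) i := by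
    have hy : Function.Injective (![0, 1, 2, 3] : Fin 4 → Fin 6) := by decide
    have := Equiv.Perm.isMultiplyPretransitive (Fin 6) 4
    obtain ⟨σ, hσ⟩ := this.exists_smul_eq ⟨_, hx⟩ ⟨_, hy⟩
    exact ⟨σ, fun i => DFunLike.congr_fun hσ i⟩
  have s0 : σ (a 0) = 0 := hσ 0
  have s1 : σ (b 0) = 1 := hσ 1
  have s2 : σ (a 1) = 2 := hσ 2
  have s3 : σ (b 1) = 3 := hσ 3
  let g : ℕ → ℕ := fun p => mask (σ (a p)) (σ (b p))
  have hn : ∀ v, σ (a v) ≠ σ (b v) := fun v => σ.injective.ne (h v)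
  have key := noExt_sound g (fun p _ => mask_mem _ _ (hn _)) (by
    intro p hp q hq
    rcases chk_cases ⟨p, hp⟩ ⟨q, by omega⟩ hq with ⟨c1, c2, w, c3, c4⟩ | ⟨c1, c2, c3⟩ | ⟨c1, c2⟩
    · simp only at c1 c2 c3 c4
      unfold chk
      rw [c1]
      obtain ⟨k1, k2⟩ := hd _ _ w c2 c3 c4
      exact mask_ne _ _ _ _ (hn _) (hn _) (by simpa using k1) (by simpa using k2)
    · simp only at c1 c2 c3
      unfold chk
      rw [c1, c2]
      obtain ⟨k1, k2, k3, k4⟩ := hadj _ _ c3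
      exact mask_disj _ _ _ _ ⟨hn _, hn _, σ.injective.ne k1, σ.injective.ne k2,
        σ.injective.ne k3, σ.injective.ne k4⟩
    · simp only at c1 c2
      unfold chk
      rw [c1, c2]) 12 2 rfl
  have hp : pre g 2 = [12, 3] := by
    have g0 : g 0 = 3 := by simp [g, s0, s1, mask]
    have g1 : g 1 = 12 := by simp [g, s2, s3, mask]
    simp [pre, g0, g1]
  rw [hp, search] at key
  exact absurd key (by decide)

lemma A_adj {u v : ZMod 14} (h : A u v) : heawoodGraph.Adj u v := by
  unfold heawoodGraph
  rw [SimpleGraph.fromRel_adj]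
  exact h

lemma main : ¬ ∃ f : ZMod 14 → Finset ℕ, IsTToneColoring heawoodGraph 2 6 f := by
  rintro ⟨f, hf, hd⟩
  have hex : ∀ v, ∃ a b : Fin 6, a ≠ b ∧ f v = {a.val + 1, b.val + 1} := by
    intro v
    obtain ⟨h1, h2⟩ := hf v
    obtain ⟨x, y, hxy, he⟩ := Finset.card_eq_two.mp h1
    have hx := Finset.mem_Icc.mp (h2 (by rw [he]; simp : x ∈ f v))
    have hy := Finset.mem_Icc.mp (h2 (by rw [he]; simp : y ∈ f v))
    refine ⟨⟨x - 1, by omega⟩, ⟨y - 1, by omega⟩, ?_, ?_⟩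
    · intro h
      have := congrArg Fin.val h
      simp only at this
      omega
    · simp only
      rw [he, Nat.sub_add_cancel hx.1, Nat.sub_add_cancel hy.1]
  choose a b hab hfe using hex
  have hA : ∀ u v, A u v → Disjoint (f u) (f v) := by
    intro u v h
    have h1 := hd u v h.1
    rw [SimpleGraph.edist_eq_one_iff_adj.mpr (A_adj h)] at h1
    have h2 : (f u ∩ f v).card < 1 := by exact_mod_cast h1
    rw [Finset.disjoint_iff_inter_eq_empty, ← Finset.card_eq_zero]
    omega
  apply core a b hab
  · intro u v h
    have h1 := hA u v h
    rw [hfe u, hfe v, Finset.disjoint_left] at h1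
    simp only [Finset.mem_insert, Finset.mem_singleton, forall_eq_or_imp, forall_eq] at h1
    refine ⟨?_, ?_, ?_, ?_⟩ <;> intro h2 <;> simp [h2] at h1
  · intro u v w huv h1 h2
    have hne : f u ≠ f v := by
      intro he
      have h3 := hd u v huv
      rw [he, Finset.inter_self, (hf v).1] at h3
      have h4 : heawoodGraph.edist u v ≤ 1 + 1 := by
        refine (SimpleGraph.edist_triangle (v := w)).trans ?_
        rw [SimpleGraph.edist_eq_one_iff_adj.mpr (A_adj h1),
          SimpleGraph.edist_eq_one_iff_adj.mpr (A_adj h2)]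
      have h5 := h3.trans_le h4
      norm_num at h5
    rw [hfe u, hfe v] at hne
    constructor
    · rintro ⟨p, q⟩
      exact hne (by rw [p, q])
    · rintro ⟨p, q⟩
      exact hne (by rw [p, q, Finset.pair_comm])

lemma nonempty : {k | ∃ f : ZMod 14 → Finset ℕ, IsTToneColoring heawoodGraph 2 k f}.Nonempty := by
  refine ⟨28, fun v => {2 * v.val + 1, 2 * v.val + 2}, fun v => ⟨?_, ?_⟩, ?_⟩
  · exact Finset.card_pair (by omega)
  · have := ZMod.val_lt v
    intro x hx
    simp only [Finset.mem_insert, Finset.mem_singleton] at hx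
    rw [Finset.mem_Icc]
    omega
  · intro u v huv
    have hv : u.val ≠ v.val := fun h => huv (ZMod.val_injective 14 h)
    have : (({2 * u.val + 1, 2 * u.val + 2} : Finset ℕ) ∩ {2 * v.val + 1, 2 * v.val + 2}) = ∅ := by
      rw [← Finset.disjoint_iff_inter_eq_empty, Finset.disjoint_left]
      intro x hx hy
      simp only [Finset.mem_insert, Finset.mem_singleton] at hx hy
      omega
    simp only [this, Finset.card_empty, Nat.cast_zero]
    exact SimpleGraph.edist_pos_of_ne huv

end HW

theorem heawood_not_twoTone_six_colorable :
    (¬ ∃ f : ZMod 14 → Finset ℕ, IsTToneColoring heawoodGraph 2 6 f) ∧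
      6 < toneNumber heawoodGraph 2 := by
  refine ⟨HW.main, ?_⟩
  by_contra hlt
  obtain ⟨f, hf, hd⟩ := Nat.sInf_mem HW.nonempty
  refine HW.main ⟨f, fun v => ⟨(hf v).1, (hf v).2.trans ?_⟩, hd⟩
  exact Finset.Icc_subset_Icc le_rfl (not_lt.mp hlt)
end

section
/- The 2-tone chromatic number of the Heawood graph equals 7; in particular the Heawood graph has a 2-tone 7-coloring. -/
namespace HW

instance : DecidableRel heawoodGraph.Adj := fun a b =>
  decidable_of_iff (a ≠ b ∧ ((b = a + 1 ∨ (Even a.val ∧ b = a + 5)) ∨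
    (a = b + 1 ∨ (Even b.val ∧ a = b + 5)))) (by
      unfold heawoodGraph; rw [SimpleGraph.fromRel_adj])

/-- Incidence of the Fano plane: point `i` is the vertex `2 i`, line `j` the vertex `2 j + 1`;
the flag swaps the roles. -/
def inc (b : Bool) (i j : Fin 7) : Bool :=
  let d := if b then j - i else i - j
  d == 0 || d == 6 || d == 2

/-- Lines avoiding a point set. -/
def av (b : Bool) (P : Finset (Fin 7)) : Finset (Fin 7) :=
  Finset.univ.filter (fun j => ∀ i ∈ P, inc b i j = false)

set_option maxRecDepth 100000 in
theorem fact1 : ∀ b : Bool, ∀ P : Finset (Fin 7), P.card ≤ 5 → P ≠ ∅ →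
    P.card + (av b P).card ≤ 5 ∧
    (P.card + (av b P).card = 5 → 4 ≤ P.card ∨ 4 ≤ (av b P).card) := by
  decide +kernel

/-- Tight sets. -/
def tight (b : Bool) : Finset (Finset (Fin 7)) :=
  Finset.univ.filter (fun P => 4 ≤ P.card ∧ P.card ≤ 5 ∧ 5 ≤ P.card + (av b P).card)

set_option maxRecDepth 100000 in
theorem fact2 : ∀ b : Bool, ∀ P ∈ tight b, ∀ Q ∈ tight b, 2 ≤ (P ∩ Q).card := by
  decide +kernel

/-- Points having a given colour. -/
def cls (p : Fin 7 → Finset ℕ) (c : ℕ) : Finset (Fin 7) := Finset.univ.filter (fun i => c ∈ p i)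

theorem cls_le {p : Fin 7 → Finset ℕ} (h2 : ∀ i, (p i).card = 2 ∧ p i ⊆ Finset.Icc 1 6)
    (hinj : Function.Injective p) {c : ℕ} (hc : c ∈ Finset.Icc 1 6) : (cls p c).card ≤ 5 := by
  have h5 : ∀ c ∈ Finset.Icc 1 6,
      (((Finset.Icc 1 6).powersetCard 2).filter (fun s => c ∈ s)).card = 5 := by decide +kernel
  rw [← h5 c hc]
  refine Finset.card_le_card_of_injOn p ?_ hinj.injOn
  intro i hi
  simp only [cls, Finset.coe_filter, Finset.mem_univ, true_and, Set.mem_ofPred_eq] at hi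
  simp only [Finset.coe_filter, Finset.mem_powersetCard, Set.mem_ofPred_eq]
  exact ⟨⟨(h2 i).2, (h2 i).1⟩, hi⟩

theorem cls_inter {p : Fin 7 → Finset ℕ} (h2 : ∀ i, (p i).card = 2 ∧ p i ⊆ Finset.Icc 1 6)
    (hinj : Function.Injective p) {c d : ℕ} (hcd : c ≠ d) : (cls p c ∩ cls p d).card ≤ 1 := by
  have key : ∀ i ∈ cls p c ∩ cls p d, p i = {c, d} := by
    intro i hi
    simp only [cls, Finset.mem_inter, Finset.mem_filter, Finset.mem_univ, true_and] at hi
    symm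
    apply Finset.eq_of_subset_of_card_le
    · intro x hx
      simp only [Finset.mem_insert, Finset.mem_singleton] at hx
      rcases hx with rfl | rfl
      exacts [hi.1, hi.2]
    · rw [(h2 i).1, Finset.card_pair hcd]
  rw [Finset.card_le_one]
  intro a ha b hb
  exact hinj ((key a ha).trans (key b hb).symm)

theorem cls_av {b : Bool} {p l : Fin 7 → Finset ℕ}
    (hd : ∀ i j, inc b i j = true → Disjoint (p i) (l j)) (c : ℕ) :
    cls l c ⊆ av b (cls p c) := by
  intro j hj
  simp only [cls, av, Finset.mem_filter, Finset.mem_univ, true_and] at hj ⊢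
  intro i hi
  by_contra h
  exact Finset.disjoint_left.1 (hd i j (by simpa using h)) hi hj

theorem few {b : Bool} {p l : Fin 7 → Finset ℕ}
    (h2 : ∀ i, (p i).card = 2 ∧ p i ⊆ Finset.Icc 1 6) (hinj : Function.Injective p)
    (hd : ∀ i j, inc b i j = true → Disjoint (p i) (l j)) :
    ((Finset.Icc 1 6).filter
      (fun c => 5 ≤ (cls p c).card + (cls l c).card ∧ 4 ≤ (cls p c).card)).card ≤ 1 := by
  have ht : ∀ c, c ∈ (Finset.Icc 1 6).filter
      (fun c => 5 ≤ (cls p c).card + (cls l c).card ∧ 4 ≤ (cls p c).card) →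
      cls p c ∈ tight b := by
    intro c hc
    rw [Finset.mem_filter] at hc
    have h1 := Finset.card_le_card (cls_av hd c)
    have h3 := cls_le h2 hinj hc.1
    simp only [tight, Finset.mem_filter, Finset.mem_univ, true_and]
    omega
  rw [Finset.card_le_one]
  intro c hc d hdd
  by_contra hne
  have := fact2 b _ (ht c hc) _ (ht d hdd)
  have := cls_inter h2 hinj hne
  omega

theorem sum_cls {p : Fin 7 → Finset ℕ} (h2 : ∀ i, (p i).card = 2 ∧ p i ⊆ Finset.Icc 1 6) :
    ∑ c ∈ Finset.Icc 1 6, (cls p c).card = 14 := by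
  have : ∀ i, ∑ c ∈ Finset.Icc 1 6, (if c ∈ p i then 1 else 0) = 2 := by
    intro i
    rw [← Finset.card_filter, ← (h2 i).1]
    congr 1
    ext x
    simp only [Finset.mem_filter, and_iff_right_iff_imp]
    exact fun h => (h2 i).2 h
  simp only [cls, Finset.card_filter]
  rw [Finset.sum_comm]
  simp [this]

theorem core_s5 {p l : Fin 7 → Finset ℕ}
    (hp : ∀ i, (p i).card = 2 ∧ p i ⊆ Finset.Icc 1 6) (hpi : Function.Injective p)
    (hl : ∀ i, (l i).card = 2 ∧ l i ⊆ Finset.Icc 1 6) (hli : Function.Injective l)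
    (hd : ∀ i j, inc true i j = true → Disjoint (p i) (l j)) : False := by
  have hd' : ∀ i j, inc false i j = true → Disjoint (l i) (p j) :=
    fun i j h => (hd j i (by simpa [inc] using h)).symm
  have hA := few hp hpi hd
  have hB := few hl hli hd'
  have hb : ∀ c ∈ Finset.Icc 1 6, (cls p c).card + (cls l c).card ≤ 4 +
      (if 5 ≤ (cls p c).card + (cls l c).card ∧ 4 ≤ (cls p c).card then 1 else 0) +
      (if 5 ≤ (cls l c).card + (cls p c).card ∧ 4 ≤ (cls l c).card then 1 else 0) := by
    intro c hc
    have h1 := cls_le hp hpi hc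
    have h2 := cls_le hl hli hc
    have h3 := Finset.card_le_card (cls_av hd c)
    by_cases he : cls p c = ∅
    · have h0 : (cls p c).card = 0 := Finset.card_eq_zero.2 he
      split_ifs <;> omega
    · have := fact1 true _ h1 he
      split_ifs <;> omega
  have hs := Finset.sum_le_sum hb
  rw [Finset.sum_add_distrib, Finset.sum_add_distrib, Finset.sum_add_distrib, sum_cls hp,
    sum_cls hl, ← Finset.card_filter, ← Finset.card_filter] at hs
  simp only [Finset.sum_const, Nat.card_Icc, smul_eq_mul] at hs
  omega

/-- Vertex of a point. -/
def pt (i : Fin 7) : ZMod 14 := 2 * (i.val : ZMod 14)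
/-- Vertex of a line. -/
def ln (i : Fin 7) : ZMod 14 := 2 * (i.val : ZMod 14) + 1

theorem adj_of_inc : ∀ i j, inc true i j = true → heawoodGraph.Adj (pt i) (ln j) := by
  decide +kernel
theorem pt_common : ∀ i j, i ≠ j → pt i ≠ pt j ∧
    ∃ k, heawoodGraph.Adj (pt i) k ∧ heawoodGraph.Adj k (pt j) := by
  decide +kernel
theorem ln_common : ∀ i j, i ≠ j → ln i ≠ ln j ∧
    ∃ k, heawoodGraph.Adj (ln i) k ∧ heawoodGraph.Adj k (ln j) := by
  decide +kernel

theorem ne_of_common {k : ℕ} {f : ZMod 14 → Finset ℕ} (hf : IsTToneColoring heawoodGraph 2 k f)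
    {u v : ZMod 14}
    (h : u ≠ v ∧ ∃ k, heawoodGraph.Adj u k ∧ heawoodGraph.Adj k v) : f u ≠ f v := by
  obtain ⟨hne, w, h1, h2⟩ := h
  intro he
  have h3 := hf.2 u v hne
  rw [he, Finset.inter_self, (hf.1 v).1] at h3
  have h4 := SimpleGraph.edist_le (SimpleGraph.Walk.cons h1 (SimpleGraph.Walk.cons h2 .nil))
  simp only [SimpleGraph.Walk.length_cons, SimpleGraph.Walk.length_nil] at h4
  exact absurd h3 (not_lt.2 h4)

theorem lower {k : ℕ} {f : ZMod 14 → Finset ℕ} (hf : IsTToneColoring heawoodGraph 2 k f) :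
    7 ≤ k := by
  by_contra hk
  have hsub : ∀ v, (f v).card = 2 ∧ f v ⊆ Finset.Icc 1 6 := fun v =>
    ⟨(hf.1 v).1, (hf.1 v).2.trans (Finset.Icc_subset_Icc_right (by omega))⟩
  refine core_s5 (p := fun i => f (pt i)) (l := fun i => f (ln i)) (fun i => hsub _) ?_
    (fun i => hsub _) ?_ ?_
  · intro i j h
    by_contra hne
    exact ne_of_common hf (pt_common i j hne) h
  · intro i j h
    by_contra hne
    exact ne_of_common hf (ln_common i j hne) h
  · intro i j h
    have ha := adj_of_inc i j h
    have h1 := hf.2 _ _ ha.ne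
    rw [SimpleGraph.edist_eq_one_iff_adj.2 ha] at h1
    rw [Finset.disjoint_iff_inter_eq_empty, ← Finset.card_eq_zero]
    have : (f (pt i) ∩ f (ln j)).card < 1 := by exact_mod_cast h1
    omega

/-- The colouring. -/
def col (v : ZMod 14) : Finset ℕ :=
  (![{1, 2}, {3, 4}, {1, 5}, {2, 3}, {1, 4}, {3, 5}, {1, 6}, {2, 4}, {1, 3}, {2, 5}, {6, 7},
    {4, 5}, {1, 7}, {4, 6}] : Fin 14 → Finset ℕ) v

theorem col1 : ∀ v, (col v).card = 2 ∧ col v ⊆ Finset.Icc 1 7 := by decide +kernel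
theorem col2 : ∀ u v, u ≠ v → (col u ∩ col v).card ≤ 1 ∧
    (heawoodGraph.Adj u v → (col u ∩ col v).card = 0) := by decide +kernel

theorem col_ok : IsTToneColoring heawoodGraph 2 7 col := by
  refine ⟨col1, fun u v hne => ?_⟩
  obtain ⟨h1, h2⟩ := col2 u v hne
  have hpos := SimpleGraph.edist_pos_of_ne (G := heawoodGraph) hne
  by_cases ha : heawoodGraph.Adj u v
  · rw [h2 ha]
    exact_mod_cast hpos
  · refine lt_of_le_of_lt (b := (1 : ℕ∞)) (by exact_mod_cast h1) ?_
    refine lt_of_le_of_ne (Order.one_le_iff_pos.2 hpos) ?_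
    intro h
    exact ha (SimpleGraph.edist_eq_one_iff_adj.1 h.symm)

end HW

theorem heawood_twoTone_eq_seven :
    toneNumber heawoodGraph 2 = 7 ∧
      ∃ f : ZMod 14 → Finset ℕ, IsTToneColoring heawoodGraph 2 7 f := by
  refine ⟨le_antisymm (Nat.sInf_le ⟨HW.col, HW.col_ok⟩) ?_, HW.col, HW.col_ok⟩
  refine le_csInf ⟨7, HW.col, HW.col_ok⟩ ?_
  rintro k ⟨f, hf⟩
  exact HW.lower hf
end

section
/- Let G be a finite simple graph with maximum degree at most 3, let f be a partial 2-tone 8-coloring of G, and let v be an uncolored vertex. If v has at least one uncolored neighbor and at least one uncolored vertex at distance exactly 2, then f can be extended to v (i.e., some 2-element subset of {1,…,8} may be assigned to v so that the result is again a partial 2-tone 8-coloring). -/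
/-- A partial 2-tone 8-coloring of `G`: some vertices receive 2-element subsets of
`{1, …, 8}` (the rest are uncolored, i.e. `none`), and colored vertices `u ≠ v` share
fewer than `d(u,v)` colors. -/
def IsPartial2Tone8Coloring {V : Type*} (G : SimpleGraph V)
    (f : V → Option (Finset ℕ)) : Prop :=
  (∀ v L, f v = some L → L.card = 2 ∧ L ⊆ Finset.Icc 1 8) ∧
  ∀ u v Lu Lv, u ≠ v → f u = some Lu → f v = some Lv →
    ((Lu ∩ Lv).card : ℕ∞) < G.edist u v

/-- An extension of a partial 2-tone 8-coloring `f` to an uncolored vertex `v`: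
a partial 2-tone 8-coloring that assigns a label to `v` and agrees with `f` elsewhere. -/
def IsExtensionAt {V : Type*} (G : SimpleGraph V)
    (f g : V → Option (Finset ℕ)) (v : V) : Prop :=
  IsPartial2Tone8Coloring G g ∧ (g v).isSome ∧ ∀ u, u ≠ v → g u = f u

theorem aux_dist {V : Type*} (G : SimpleGraph V) (v u : V) (h : u ≠ v) (h2 : G.edist v u ≤ 2) :
    G.Adj v u ∨ ∃ w, G.Adj v w ∧ G.Adj w u := by
  have hne : G.edist v u ≠ ⊤ := by
    intro h3
    rw [h3] at h2
    exact absurd h2 (by decide)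
  obtain ⟨p, hp⟩ := SimpleGraph.exists_walk_of_edist_ne_top hne
  rw [← hp] at h2
  have h4 : p.length ≤ 2 := by exact_mod_cast h2
  cases p with
  | nil => exact absurd rfl h
  | cons a q =>
    cases q with
    | nil => exact Or.inl a
    | cons b r =>
      cases r with
      | nil => exact Or.inr ⟨_, a, b⟩
      | cons c s => simp at h4

theorem extend_partial_coloring_of_uncolored_neighbors
    {V : Type*} [Fintype V] (G : SimpleGraph V) [DecidableRel G.Adj]
    (hΔ : G.maxDegree ≤ 3)
    (f : V → Option (Finset ℕ)) (hf : IsPartial2Tone8Coloring G f)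
    (v : V) (hv : f v = none)
    (hnbr : ∃ w, G.Adj v w ∧ f w = none)
    (hsecond : ∃ x, G.edist v x = 2 ∧ f x = none) :
    ∃ g, IsExtensionAt G f g v := by
  classical
  obtain ⟨w, hvw, hw⟩ := hnbr
  obtain ⟨x, hvx, hx⟩ := hsecond
  obtain ⟨hf1, hf2⟩ := hf
  have hdeg : ∀ u, (G.neighborFinset u).card ≤ 3 := fun u => by
    rw [SimpleGraph.card_neighborFinset_eq_degree]
    exact (G.degree_le_maxDegree u).trans hΔ
  let lab : V → Finset ℕ := fun u => (f u).getD ∅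
  have hlab : ∀ u, (lab u).card ≤ 2 := by
    intro u
    cases h : f u with
    | none => simp [lab, h]
    | some L => simpa [lab, h] using (hf1 u L h).1.le
  have hxv : x ≠ v := by
    rintro rfl
    simp at hvx
  have hxadj : ¬ G.Adj v x := by
    intro h
    rw [SimpleGraph.edist_eq_one_iff_adj.mpr h] at hvx
    exact absurd hvx (by decide)
  let N := G.neighborFinset v
  let U := (N.erase w).biUnion lab
  have hU : U.card ≤ 4 := by
    have h1 : U.card ≤ (N.erase w).card * 2 :=
      Finset.card_biUnion_le_card_mul _ _ _ (fun u _ => hlab u)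
    have h2 : (N.erase w).card = N.card - 1 :=
      Finset.card_erase_of_mem (by simpa [N] using hvw)
    have h3 : N.card ≤ 3 := hdeg v
    omega
  let D := N.biUnion (fun w => (G.neighborFinset w).erase v)
  have hD : D.card ≤ 6 := by
    have h1 : D.card ≤ N.card * 2 := by
      refine Finset.card_biUnion_le_card_mul _ _ _ (fun u hu => ?_)
      have hu' : G.Adj v u := by simpa [N] using hu
      rw [Finset.card_erase_of_mem (by simpa using hu'.symm)]
      have := hdeg u
      omega
    have h3 : N.card ≤ 3 := hdeg v
    omega
  have hxD : x ∈ D := by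
    rcases aux_dist G v x hxv hvx.le with h | ⟨y, h1, h2⟩
    · exact absurd h hxadj
    · simp only [D, N, Finset.mem_biUnion, Finset.mem_erase, SimpleGraph.mem_neighborFinset]
      exact ⟨y, h1, hxv, h2⟩
  let F := (D.erase x).image lab
  have hF : F.card ≤ 5 := by
    have h1 : F.card ≤ (D.erase x).card := Finset.card_image_le
    rw [Finset.card_erase_of_mem hxD] at h1
    omega
  let A := Finset.Icc 1 8 \ U
  have hA : 4 ≤ A.card := by
    have h1 := Finset.le_card_sdiff U (Finset.Icc 1 8)
    simp only [Nat.card_Icc] at h1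
    change _ ≤ A.card at h1
    omega
  have hP : 6 ≤ (A.powersetCard 2).card := by
    rw [Finset.card_powersetCard]
    exact (Nat.choose_le_choose 2 hA)
  obtain ⟨L, hLP, hLF⟩ := Finset.exists_mem_notMem_of_card_lt_card
    (show F.card < (A.powersetCard 2).card by omega)
  obtain ⟨hLA, hL2⟩ := Finset.mem_powersetCard.mp hLP
  have key : ∀ u Lu, u ≠ v → f u = some Lu → ((L ∩ Lu).card : ℕ∞) < G.edist v u := by
    intro u Lu huv hu
    have hLu := (hf1 u Lu hu).1
    have hlu : lab u = Lu := by simp [lab, hu]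
    by_contra hcon
    push Not at hcon
    have hle2 : (L ∩ Lu).card ≤ 2 := hL2 ▸ Finset.card_le_card Finset.inter_subset_left
    have hpos : G.edist v u ≠ 0 := by
      rw [Ne, SimpleGraph.edist_eq_zero_iff]
      exact huv.symm
    have hd2 : G.edist v u ≤ 2 := hcon.trans (by exact_mod_cast hle2)
    have hnadj : ¬ G.Adj v u := by
      intro hadj
      have hsub : Lu ⊆ U := by
        rw [← hlu]
        refine Finset.subset_biUnion_of_mem lab (Finset.mem_erase.mpr ⟨?_, by simpa [N] using hadj⟩)
        rintro rfl
        simp [hw] at hu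
      have : L ∩ Lu = ∅ := by
        ext a
        simp only [Finset.mem_inter, Finset.notMem_empty, iff_false, not_and]
        intro h1 h2
        exact (Finset.mem_sdiff.mp (hLA h1)).2 (hsub h2)
      rw [this] at hcon
      simp at hcon
      exact huv hcon.symm
    rcases aux_dist G v u huv hd2 with h | ⟨y, h1, h2⟩
    · exact hnadj h
    · have huD : u ∈ D := by
        simp only [D, N, Finset.mem_biUnion, Finset.mem_erase, SimpleGraph.mem_neighborFinset]
        exact ⟨y, h1, huv, h2⟩
      have hne : L ≠ Lu := by
        rintro rfl
        apply hLF
        refine Finset.mem_image.mpr ⟨u, Finset.mem_erase.mpr ⟨?_, huD⟩, hlu⟩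
        rintro rfl
        simp [hx] at hu
      have hle1 : (L ∩ Lu).card ≤ 1 := by
        by_contra hc
        have e1 : L ∩ Lu = L := Finset.eq_of_subset_of_card_le Finset.inter_subset_left (by omega)
        have e2 : L ∩ Lu = Lu := Finset.eq_of_subset_of_card_le Finset.inter_subset_right (by omega)
        exact hne (e1.symm.trans e2)
      have hd1 : G.edist v u ≤ 1 := hcon.trans (by exact_mod_cast hle1)
      have : G.edist v u = 1 := le_antisymm hd1 (Order.one_le_iff_pos.mpr (pos_iff_ne_zero.mpr hpos))
      exact hnadj (SimpleGraph.edist_eq_one_iff_adj.mp this)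
  refine ⟨Function.update f v (some L), ⟨?_, ?_⟩, by simp, fun u hu => by simp [hu]⟩
  · intro u Lu hu
    by_cases h : u = v
    · subst h
      simp at hu
      subst hu
      exact ⟨hL2, hLA.trans Finset.sdiff_subset⟩
    · rw [Function.update_of_ne h] at hu
      exact hf1 u Lu hu
  · intro a b La Lb hab ha hb
    by_cases h : a = v
    · subst h
      rw [Function.update_of_ne hab.symm] at hb
      simp at ha
      subst ha
      exact key b Lb hab.symm hb
    · rw [Function.update_of_ne h] at ha
      by_cases h' : b = v
      · subst h'
        simp at hb
        subst hb
        rw [Finset.inter_comm, SimpleGraph.edist_comm]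
        exact key a La h ha
      · rw [Function.update_of_ne h'] at hb
        exact hf2 a b La Lb hab ha hb
end

section
/- Let G be a finite simple 3-regular graph, let v be a vertex of G, and let w₁ and w₂ be distinct neighbors of v. Let f be a partial 2-tone 8-coloring of G under which v, w₁, and w₂ are all uncolored, and let f₁ and f₂ be two distinct extensions of f to w₁. If there exist two distinct vertices at distance exactly 2 from v, neither of which yields an obstruction of v under f₁ or under f₂, then for some i ∈ {1,2} the coloring fᵢ has at least three distinct extensions to v. -/
/-- A candidate label for `v` under `g`: a 2-element subset of `{1, …, 8}` disjoint
from the labels of all colored neighbors of `v`. -/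
def IsCandidateLabel {V : Type*} (G : SimpleGraph V)
    (g : V → Option (Finset ℕ)) (v : V) (L : Finset ℕ) : Prop :=
  L.card = 2 ∧ L ⊆ Finset.Icc 1 8 ∧
    ∀ u Lu, G.Adj v u → g u = some Lu → Disjoint L Lu

/-- A vertex `x` yields an obstruction of `v` under `g` if `x` is colored and its label
is a candidate label for `v`. -/
def YieldsObstruction {V : Type*} (G : SimpleGraph V)
    (g : V → Option (Finset ℕ)) (v x : V) : Prop :=
  ∃ L, g x = some L ∧ IsCandidateLabel G g v L

theorem t28_ext {V : Type*} [DecidableEq V] (G : SimpleGraph V) (f : V → Option (Finset ℕ)) (v : V)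
    (L : Finset ℕ) (hf : IsPartial2Tone8Coloring G f) (hL : IsCandidateLabel G f v L)
    (h2 : ∀ x, G.edist v x = 2 → f x ≠ some L) :
    IsExtensionAt G f (Function.update f v (some L)) v := by
  obtain ⟨hc, hs, hd⟩ := hL
  have key : ∀ x Lx, x ≠ v → f x = some Lx → ((L ∩ Lx).card : ℕ∞) < G.edist v x := by
    intro x Lx hxv hfx
    have hle : (L ∩ Lx).card ≤ 2 := hc ▸ Finset.card_le_card Finset.inter_subset_left
    by_cases h1 : G.Adj v x
    · rw [Finset.disjoint_iff_inter_eq_empty.1 (hd x Lx h1 hfx),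
        SimpleGraph.edist_eq_one_iff_adj.2 h1]
      simp
    by_cases h3 : G.edist v x = 2
    · rw [h3]
      have : (L ∩ Lx).card ≠ 2 := by
        intro h
        have e1 : L ∩ Lx = L :=
          Finset.eq_of_subset_of_card_le Finset.inter_subset_left (by omega)
        have e2 : L ∩ Lx = Lx :=
          Finset.eq_of_subset_of_card_le Finset.inter_subset_right
            (by have := (hf.1 x Lx hfx).1; omega)
        exact h2 x h3 (by rw [hfx, ← e2, e1])
      have : (L ∩ Lx).card < 2 := by omega
      exact_mod_cast this
    · have h0 : G.edist v x ≠ 0 := by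
        rw [Ne, SimpleGraph.edist_eq_zero_iff]; exact fun h => hxv h.symm
      have h1' : G.edist v x ≠ 1 := fun h => h1 (SimpleGraph.edist_eq_one_iff_adj.1 h)
      generalize G.edist v x = e at *
      induction e using ENat.recTopCoe with
      | top => exact ENat.natCast_lt_top _
      | coe n =>
        have a0 : n ≠ 0 := by exact_mod_cast h0
        have a1 : n ≠ 1 := by exact_mod_cast h1'
        have a2 : n ≠ 2 := by exact_mod_cast h3
        have : (L ∩ Lx).card < n := by omega
        exact_mod_cast this
  refine ⟨⟨?_, ?_⟩, by simp, fun u hu => Function.update_of_ne hu _ _⟩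
  · intro x Lx hx
    by_cases h : x = v
    · subst h
      simp at hx
      subst hx
      exact ⟨hc, hs⟩
    · rw [Function.update_of_ne h] at hx
      exact hf.1 x Lx hx
  · intro a b La Lb hab ha hb
    by_cases h : a = v
    · subst h
      rw [Function.update_of_ne hab.symm] at hb
      simp at ha
      subst ha
      exact key b Lb hab.symm hb
    · rw [Function.update_of_ne h] at ha
      by_cases h' : b = v
      · subst h'
        simp at hb
        subst hb
        rw [SimpleGraph.edist_comm, Finset.inter_comm]
        exact key a La hab ha
      · rw [Function.update_of_ne h'] at hb
        exact hf.2 a b La Lb hab ha hb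

theorem t28_three {V : Type*} [DecidableEq V] (G : SimpleGraph V) (f : V → Option (Finset ℕ)) (v : V)
    (S : Finset (Finset ℕ)) (hS : 2 < S.card)
    (h : ∀ L ∈ S, IsExtensionAt G f (Function.update f v (some L)) v) :
    ∃ g₁ g₂ g₃, g₁ ≠ g₂ ∧ g₁ ≠ g₃ ∧ g₂ ≠ g₃ ∧
      IsExtensionAt G f g₁ v ∧ IsExtensionAt G f g₂ v ∧ IsExtensionAt G f g₃ v := by
  obtain ⟨a, ha, b, hb, c, hc, hab, hac, hbc⟩ := Finset.two_lt_card.1 hS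
  have inj : ∀ p q : Finset ℕ, p ≠ q →
      Function.update f v (some p) ≠ Function.update f v (some q) := by
    intro p q hpq e
    have := congrFun e v
    simp at this
    exact hpq this
  exact ⟨_, _, _, inj a b hab, inj a c hac, inj b c hbc, h a ha, h b hb, h c hc⟩

theorem t28_half (A U : Finset ℕ) (hA : A.card = 2) (hAs : A ⊆ Finset.Icc 1 8)
    (hU : U.card ≤ 2) (T : Finset (Finset ℕ)) (hT : T.card ≤ 4)
    (h1 : ((Finset.Icc 1 8 \ (A ∪ U)).powersetCard 2 \ T).card ≤ 2) :
    (Finset.Icc 1 8 \ (A ∪ U)).card = 4 ∧ T ⊆ (Finset.Icc 1 8 \ (A ∪ U)).powersetCard 2 ∧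
    T.card = 4 ∧ A = (Finset.Icc 1 8 \ (Finset.Icc 1 8 \ (A ∪ U))) \ U := by
  have hAU := Finset.card_union_le A U
  have hC : 4 ≤ (Finset.Icc 1 8 \ (A ∪ U)).card := by
    have := Finset.le_card_sdiff (A ∪ U) (Finset.Icc 1 8)
    simp at this
    omega
  have hlow := Finset.le_card_sdiff T ((Finset.Icc 1 8 \ (A ∪ U)).powersetCard 2)
  have hC4 : (Finset.Icc 1 8 \ (A ∪ U)).card = 4 := by
    by_contra hne
    have h5 : 5 ≤ (Finset.Icc 1 8 \ (A ∪ U)).card := by omega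
    have := Nat.choose_le_choose 2 h5
    rw [Finset.card_powersetCard] at hlow
    have e : Nat.choose 5 2 = 10 := rfl
    omega
  have hP : ((Finset.Icc 1 8 \ (A ∪ U)).powersetCard 2).card = 6 := by
    rw [Finset.card_powersetCard, hC4]; rfl
  have hi := Finset.card_sdiff_add_card_inter ((Finset.Icc 1 8 \ (A ∪ U)).powersetCard 2) T
  have hTi : ((Finset.Icc 1 8 \ (A ∪ U)).powersetCard 2) ∩ T = T :=
    Finset.eq_of_subset_of_card_le Finset.inter_subset_right (by omega)
  refine ⟨hC4, ?_, ?_, ?_⟩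
  · rw [← hTi]; exact Finset.inter_subset_left
  · rw [hTi] at hi; omega
  · have hb := Finset.card_sdiff_add_card_inter (Finset.Icc 1 8) (A ∪ U)
    have h8 : (Finset.Icc 1 8).card = 8 := by simp
    have hl : (Finset.Icc 1 8 ∩ (A ∪ U)).card ≤ (A ∪ U).card :=
      Finset.card_le_card Finset.inter_subset_right
    have hui := Finset.card_union_add_card_inter A U
    have h0 : (A ∩ U).card = 0 := by omega
    rw [Finset.card_eq_zero] at h0
    ext z
    have hz := Finset.ext_iff.1 h0 z
    have hz2 := @hAs z
    simp only [Finset.mem_inter, Finset.notMem_empty, iff_false] at hz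
    simp only [Finset.mem_sdiff, Finset.mem_union]
    tauto

theorem t28_count (A B U : Finset ℕ) (hA : A.card = 2) (hB : B.card = 2)
    (hAs : A ⊆ Finset.Icc 1 8) (hBs : B ⊆ Finset.Icc 1 8)
    (hU : U.card ≤ 2) (hAB : A ≠ B) (T : Finset (Finset ℕ)) (hT : T.card ≤ 4) :
    2 < ((Finset.Icc 1 8 \ (A ∪ U)).powersetCard 2 \ T).card ∨
    2 < ((Finset.Icc 1 8 \ (B ∪ U)).powersetCard 2 \ T).card := by
  by_contra! hcon
  obtain ⟨a1, a2, a3, a4⟩ := t28_half A U hA hAs hU T hT hcon.1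
  obtain ⟨b1, b2, b3, b4⟩ := t28_half B U hB hBs hU T hT hcon.2
  generalize Finset.Icc 1 8 \ (A ∪ U) = C at *
  generalize Finset.Icc 1 8 \ (B ∪ U) = D at *
  have hCD : C ≠ D := by
    rintro rfl
    exact hAB (a4.trans b4.symm)
  have h3 : (C ∩ D).card ≤ 3 := by
    by_contra! h
    have e1 : C ∩ D = C := Finset.eq_of_subset_of_card_le Finset.inter_subset_left (by omega)
    have e2 : C ∩ D = D := Finset.eq_of_subset_of_card_le Finset.inter_subset_right (by omega)
    exact hCD (e1.symm.trans e2)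
  have hTs : T ⊆ (C ∩ D).powersetCard 2 := by
    intro t ht
    have p := Finset.mem_powersetCard.1 (a2 ht)
    have q := Finset.mem_powersetCard.1 (b2 ht)
    exact Finset.mem_powersetCard.2 ⟨Finset.subset_inter p.1 q.1, p.2⟩
  have := Finset.card_le_card hTs
  rw [Finset.card_powersetCard] at this
  have := Nat.choose_le_choose 2 h3
  have e : Nat.choose 3 2 = 3 := rfl
  omega

theorem t28_dist {V : Type*} [Fintype V] [DecidableEq V] (G : SimpleGraph V) [DecidableRel G.Adj]
    (hreg : G.IsRegularOfDegree 3) (v : V) (D : Finset V) (hD : ∀ x ∈ D, G.edist v x = 2) :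
    D.card ≤ 6 := by
  have hsub : D ⊆ (G.neighborFinset v).biUnion (fun w => (G.neighborFinset w).erase v) := by
    intro x hx
    have h := hD x hx
    have hne : G.edist v x ≠ ⊤ := by rw [h]; exact ENat.natCast_ne_top 2
    obtain ⟨p, hp⟩ := SimpleGraph.exists_walk_of_edist_ne_top hne
    rw [h] at hp
    have hp : p.length = 2 := by exact_mod_cast hp
    have hxv : x ≠ v := by
      rintro rfl
      simp at h
    match p, hp with
    | .cons h1 (.cons h2 .nil), _ =>
      simp only [Finset.mem_biUnion, SimpleGraph.mem_neighborFinset, Finset.mem_erase]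
      exact ⟨_, h1, hxv, h2⟩
  refine (Finset.card_le_card hsub).trans ?_
  have := Finset.card_biUnion_le_card_mul (G.neighborFinset v)
    (fun w => (G.neighborFinset w).erase v) 2 (by
      intro w hw
      rw [Finset.card_erase_of_mem, SimpleGraph.card_neighborFinset_eq_degree, hreg w]
      simpa using ((G.mem_neighborFinset v w).1 hw).symm)
  rw [SimpleGraph.card_neighborFinset_eq_degree, hreg v] at this
  exact this

theorem three_extensions_of_two_extensions
    {V : Type*} [Fintype V] (G : SimpleGraph V) [DecidableRel G.Adj]
    (hreg : G.IsRegularOfDegree 3)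
    (v w₁ w₂ : V) (hw₁ : G.Adj v w₁) (hw₂ : G.Adj v w₂) (hww : w₁ ≠ w₂)
    (f f₁ f₂ : V → Option (Finset ℕ)) (hf : IsPartial2Tone8Coloring G f)
    (hv : f v = none) (hfw₁ : f w₁ = none) (hfw₂ : f w₂ = none)
    (he₁ : IsExtensionAt G f f₁ w₁) (he₂ : IsExtensionAt G f f₂ w₁) (hne : f₁ ≠ f₂)
    (hx : ∃ x y : V, x ≠ y ∧ G.edist v x = 2 ∧ G.edist v y = 2 ∧
      ¬ YieldsObstruction G f₁ v x ∧ ¬ YieldsObstruction G f₂ v x ∧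
      ¬ YieldsObstruction G f₁ v y ∧ ¬ YieldsObstruction G f₂ v y) :
    (∃ g₁ g₂ g₃, g₁ ≠ g₂ ∧ g₁ ≠ g₃ ∧ g₂ ≠ g₃ ∧
      IsExtensionAt G f₁ g₁ v ∧ IsExtensionAt G f₁ g₂ v ∧ IsExtensionAt G f₁ g₃ v) ∨
    (∃ g₁ g₂ g₃, g₁ ≠ g₂ ∧ g₁ ≠ g₃ ∧ g₂ ≠ g₃ ∧
      IsExtensionAt G f₂ g₁ v ∧ IsExtensionAt G f₂ g₂ v ∧ IsExtensionAt G f₂ g₃ v) := by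
  classical
  obtain ⟨x, y, hxy, hx2, hy2, nx1, nx2, ny1, ny2⟩ := hx
  obtain ⟨u, hu⟩ : ∃ u, ∀ z, G.Adj v z → z = w₁ ∨ z = w₂ ∨ z = u := by
    have hc : (((G.neighborFinset v).erase w₁).erase w₂).card = 1 := by
      rw [Finset.card_erase_of_mem, Finset.card_erase_of_mem,
        SimpleGraph.card_neighborFinset_eq_degree, hreg v]
      · simpa using hw₁
      · simpa using ⟨hww.symm, hw₂⟩
    obtain ⟨u, hu⟩ := Finset.card_eq_one.1 hc
    refine ⟨u, fun z hz => ?_⟩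
    by_contra! hcon
    have : z ∈ ((G.neighborFinset v).erase w₁).erase w₂ := by
      simp [hcon.1, hcon.2.1, hz]
    rw [hu] at this
    exact hcon.2.2 (Finset.mem_singleton.1 this)
  obtain ⟨p₁, s₁, a₁⟩ := he₁
  obtain ⟨p₂, s₂, a₂⟩ := he₂
  obtain ⟨A, hA⟩ := Option.isSome_iff_exists.1 s₁
  obtain ⟨B, hB⟩ := Option.isSome_iff_exists.1 s₂
  have hAB : A ≠ B := by
    rintro rfl
    apply hne
    funext z
    by_cases hz : z = w₁
    · rw [hz, hA, hB]
    · rw [a₁ z hz, a₂ z hz]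
  obtain ⟨U, hUc, hU⟩ : ∃ U : Finset ℕ, U.card ≤ 2 ∧ ∀ L, f u = some L → L = U := by
    cases h : f u with
    | none => exact ⟨∅, by simp, by simp⟩
    | some L => exact ⟨L, (hf.1 u L h).1.le, by simp⟩
  let D : Finset V := ((Finset.univ.filter (fun z => G.edist v z = 2)).erase x).erase y
  have hD : D.card ≤ 4 := by
    have h6 := t28_dist G hreg v (Finset.univ.filter (fun z => G.edist v z = 2)) (by simp)
    have : D.card = (Finset.univ.filter (fun z => G.edist v z = 2)).card - 1 - 1 := by
      rw [Finset.card_erase_of_mem, Finset.card_erase_of_mem]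
      · simpa using hx2
      · simpa using ⟨hxy.symm, hy2⟩
    omega
  let T : Finset (Finset ℕ) := D.image (fun z => (f z).getD ∅)
  have hT : T.card ≤ 4 := Finset.card_image_le.trans hD
  have main : ∀ (g : V → Option (Finset ℕ)) (A : Finset ℕ), IsPartial2Tone8Coloring G g →
      (∀ z, z ≠ w₁ → g z = f z) → g w₁ = some A → ¬ YieldsObstruction G g v x →
      ¬ YieldsObstruction G g v y →
      ∀ L ∈ (Finset.Icc 1 8 \ (A ∪ U)).powersetCard 2 \ T,
        IsExtensionAt G g (Function.update g v (some L)) v := by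
    intro g A pg ag hA nx ny L hL
    rw [Finset.mem_sdiff, Finset.mem_powersetCard] at hL
    obtain ⟨⟨hs, hc⟩, hLT⟩ := hL
    have hcand : IsCandidateLabel G g v L := by
      refine ⟨hc, hs.trans Finset.sdiff_subset, ?_⟩
      intro z Lz hz hgz
      have hdis : Disjoint L (A ∪ U) := Finset.disjoint_of_subset_left hs Finset.sdiff_disjoint
      rw [Finset.disjoint_union_right] at hdis
      by_cases hz1 : z = w₁
      · rw [hz1, hA] at hgz
        cases hgz
        exact hdis.1
      · rw [ag z hz1] at hgz
        rcases hu z hz with h | h | h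
        · exact absurd h hz1
        · rw [h, hfw₂] at hgz
          cases hgz
        · rw [h] at hgz
          rw [hU Lz hgz]
          exact hdis.2
    refine t28_ext G g v L pg hcand ?_
    intro z hz hgz
    by_cases hzx : z = x
    · exact nx ⟨L, hzx ▸ hgz, hcand⟩
    by_cases hzy : z = y
    · exact ny ⟨L, hzy ▸ hgz, hcand⟩
    apply hLT
    have hz1 : z ≠ w₁ := by
      rintro rfl
      rw [SimpleGraph.edist_eq_one_iff_adj.2 hw₁] at hz
      exact absurd hz (by decide)
    rw [ag z hz1] at hgz
    exact Finset.mem_image.2 ⟨z, by simp [D, hzx, hzy, hz], by simp [hgz]⟩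
  obtain ⟨cA, sA⟩ := p₁.1 w₁ A hA
  obtain ⟨cB, sB⟩ := p₂.1 w₁ B hB
  rcases t28_count A B U cA cB sA sB hUc hAB T hT with h | h
  · exact Or.inl (t28_three G f₁ v _ h (main f₁ A p₁ a₁ hA nx1 ny1))
  · exact Or.inr (t28_three G f₂ v _ h (main f₂ B p₂ a₂ hB nx2 ny2))
end

section
/- Let G be a finite simple 3-regular graph, let v be a vertex of G, and let w₁ and w₂ be distinct neighbors of v. Let f be a partial 2-tone 8-coloring of G under which v, w₁, and w₂ are all uncolored, and let f₁, f₂, f₃ be three distinct extensions of f to w₁. If there is a vertex at distance exactly 2 from v that does not yield an obstruction of v under any of f₁, f₂, f₃, then for some i ∈ {1,2,3} the coloring fᵢ has at least three distinct extensions to v. -/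
lemma aux_comb (U B A₁ A₂ A₃ : Finset ℕ) (D : Finset (Finset ℕ)) (hU : U.card = 8)
    (hB : B.card ≤ 2) (hBU : B ⊆ U) (h1 : A₁.card = 2) (h2 : A₂.card = 2) (h3 : A₃.card = 2)
    (h1U : A₁ ⊆ U) (h2U : A₂ ⊆ U) (h3U : A₃ ⊆ U) (h12 : A₁ ≠ A₂) (h13 : A₁ ≠ A₃) (h23 : A₂ ≠ A₃)
    (hD : D.card ≤ 5) :
    2 < (Finset.powersetCard 2 (U \ (A₁ ∪ B)) \ D).card ∨
    2 < (Finset.powersetCard 2 (U \ (A₂ ∪ B)) \ D).card ∨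
    2 < (Finset.powersetCard 2 (U \ (A₃ ∪ B)) \ D).card := by
  by_contra hcon
  simp only [not_or, not_lt] at hcon
  obtain ⟨c1, c2, c3⟩ := hcon
  have key : ∀ A : Finset ℕ, A.card = 2 → A ⊆ U →
      (Finset.powersetCard 2 (U \ (A ∪ B)) \ D).card ≤ 2 →
      (U \ (A ∪ B)).card = 4 ∧ Disjoint A B ∧
        4 ≤ (Finset.powersetCard 2 (U \ (A ∪ B)) ∩ D).card := by
    intro A hA hAU hc
    have e1 : (U \ (A ∪ B)).card = 8 - (A ∪ B).card := by
      rw [Finset.card_sdiff_of_subset (Finset.union_subset hAU hBU), hU]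
    have e2 := Finset.card_union_add_card_inter A B
    have e3 := Finset.card_sdiff_add_card_inter (Finset.powersetCard 2 (U \ (A ∪ B))) D
    have e4 : (Finset.powersetCard 2 (U \ (A ∪ B)) ∩ D).card ≤ D.card :=
      Finset.card_le_card Finset.inter_subset_right
    rw [Finset.card_powersetCard] at e3
    have e5 : (U \ (A ∪ B)).card = 4 := by
      by_contra hne
      have : 5 ≤ (U \ (A ∪ B)).card := by omega
      have := Nat.choose_le_choose 2 this
      have h5 : Nat.choose 5 2 = 10 := rfl
      omega
    have h4 : Nat.choose 4 2 = 6 := rfl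
    rw [e5, h4] at e3
    refine ⟨e5, ?_, by omega⟩
    rw [Finset.disjoint_iff_inter_eq_empty, ← Finset.card_eq_zero]
    omega
  obtain ⟨a1, b1, d1⟩ := key A₁ h1 h1U c1
  obtain ⟨a2, b2, d2⟩ := key A₂ h2 h2U c2
  obtain ⟨a3, b3, d3⟩ := key A₃ h3 h3U c3
  have inj : ∀ A A' : Finset ℕ, A ⊆ U → A' ⊆ U → Disjoint A B → Disjoint A' B →
      (U \ (A ∪ B)).card = 4 → (U \ (A' ∪ B)).card = 4 → A ≠ A' →
      ((U \ (A ∪ B)) ∩ (U \ (A' ∪ B))).card ≤ 3 := by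
    intro A A' hA hA' dA dA' e e' hne
    by_contra hlt
    have hs : U \ (A ∪ B) ∩ (U \ (A' ∪ B)) = U \ (A ∪ B) :=
      Finset.eq_of_subset_of_card_le Finset.inter_subset_left (by omega)
    have hs' : U \ (A ∪ B) ∩ (U \ (A' ∪ B)) = U \ (A' ∪ B) :=
      Finset.eq_of_subset_of_card_le Finset.inter_subset_right (by omega)
    have he := hs.symm.trans hs'
    apply hne
    ext z
    have hz := Finset.ext_iff.1 he z
    have i1 := @hA z
    have i2 := @hA' z
    have i3 := fun h : z ∈ A => Finset.disjoint_left.1 dA h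
    have i4 := fun h : z ∈ A' => Finset.disjoint_left.1 dA' h
    simp only [Finset.mem_sdiff, Finset.mem_union] at hz
    clear * - hz i1 i2 i3 i4
    tauto
  have j12 := inj _ _ h1U h2U b1 b2 a1 a2 h12
  have j13 := inj _ _ h1U h3U b1 b3 a1 a3 h13
  have j23 := inj _ _ h2U h3U b2 b3 a2 a3 h23
  generalize U \ (A₁ ∪ B) = C1 at *
  generalize U \ (A₂ ∪ B) = C2 at *
  generalize U \ (A₃ ∪ B) = C3 at *
  have pint : ∀ X Y : Finset ℕ, Finset.powersetCard 2 X ∩ Finset.powersetCard 2 Y =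
      Finset.powersetCard 2 (X ∩ Y) := by
    intro X Y
    ext z
    simp only [Finset.mem_inter, Finset.mem_powersetCard, Finset.subset_inter_iff]
    clear * -
    tauto
  have h32 : Nat.choose 3 2 = 3 := rfl
  have pair : ∀ X Y : Finset ℕ, (X ∩ Y).card ≤ 3 →
      4 ≤ (Finset.powersetCard 2 X ∩ D).card → 4 ≤ (Finset.powersetCard 2 Y ∩ D).card →
      (Finset.powersetCard 2 X ∩ Finset.powersetCard 2 Y).card = 3 ∧
      Finset.powersetCard 2 X ∩ Finset.powersetCard 2 Y ⊆ D := by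
    intro X Y hXY hX hY
    have u1 := Finset.card_union_add_card_inter (Finset.powersetCard 2 X ∩ D)
      (Finset.powersetCard 2 Y ∩ D)
    have u2 : (Finset.powersetCard 2 X ∩ D ∪ Finset.powersetCard 2 Y ∩ D).card ≤ D.card :=
      Finset.card_le_card (Finset.union_subset Finset.inter_subset_right Finset.inter_subset_right)
    have u3 : (Finset.powersetCard 2 X ∩ Finset.powersetCard 2 Y).card ≤ 3 := by
      rw [pint, Finset.card_powersetCard]
      have := Nat.choose_le_choose 2 hXY
      omega
    have u4 : (Finset.powersetCard 2 X ∩ D) ∩ (Finset.powersetCard 2 Y ∩ D) ⊆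
      Finset.powersetCard 2 X ∩ Finset.powersetCard 2 Y :=
      Finset.inter_subset_inter Finset.inter_subset_left Finset.inter_subset_left
    have u5 := Finset.eq_of_subset_of_card_le u4 (by omega)
    constructor
    · have := congrArg Finset.card u5
      omega
    · rw [← u5]
      exact Finset.inter_subset_left.trans Finset.inter_subset_right
  obtain ⟨p12, q12⟩ := pair C1 C2 j12 d1 d2
  obtain ⟨p13, q13⟩ := pair C1 C3 j13 d1 d3
  obtain ⟨p23, q23⟩ := pair C2 C3 j23 d2 d3
  have ht : (Finset.powersetCard 2 C1 ∩ Finset.powersetCard 2 C2 ∩ Finset.powersetCard 2 C3).card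
      ≠ 2 := by
    rw [pint, pint, Finset.card_powersetCard]
    have : (C1 ∩ C2 ∩ C3).card ≤ 3 := (Finset.card_le_card Finset.inter_subset_left).trans j12
    interval_cases (C1 ∩ C2 ∩ C3).card <;> decide
  generalize Finset.powersetCard 2 C1 = P1 at *
  generalize Finset.powersetCard 2 C2 = P2 at *
  generalize Finset.powersetCard 2 C3 = P3 at *
  -- first count
  have s1 := Finset.card_union_add_card_inter (P1 ∩ P2) (P1 ∩ P3)
  have s2 := Finset.card_union_add_card_inter (P1 ∩ P2 ∪ P1 ∩ P3) (P2 ∩ P3)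
  have s3 : (P1 ∩ P2) ∩ (P1 ∩ P3) = P1 ∩ P2 ∩ P3 := by
    ext z; simp only [Finset.mem_inter]; clear * -; tauto
  have s4 : (P1 ∩ P2 ∪ P1 ∩ P3) ∩ (P2 ∩ P3) = P1 ∩ P2 ∩ P3 := by
    ext z; simp only [Finset.mem_inter, Finset.mem_union]; clear * -; tauto
  have s5 : (P1 ∩ P2 ∪ P1 ∩ P3 ∪ P2 ∩ P3).card ≤ D.card :=
    Finset.card_le_card (Finset.union_subset (Finset.union_subset q12 q13) q23)
  have s6 : (P1 ∩ P2 ∩ P3).card ≤ (P1 ∩ P2).card := Finset.card_le_card Finset.inter_subset_left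
  rw [s3] at s1
  rw [s4] at s2
  -- second count
  have t1 := Finset.card_union_add_card_inter (P1 ∩ D) (P2 ∩ D)
  have t2 := Finset.card_union_add_card_inter (P1 ∩ D ∪ P2 ∩ D) (P3 ∩ D)
  have t3 : ((P1 ∩ D) ∩ (P2 ∩ D)).card ≤ (P1 ∩ P2).card :=
    Finset.card_le_card (Finset.inter_subset_inter Finset.inter_subset_left
      Finset.inter_subset_left)
  have t4 : ((P1 ∩ D ∪ P2 ∩ D) ∩ (P3 ∩ D)).card ≤ (P1 ∩ P3 ∪ P2 ∩ P3).card := by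
    apply Finset.card_le_card
    intro z; simp only [Finset.mem_inter, Finset.mem_union]; clear * -; tauto
  have t5 := Finset.card_union_add_card_inter (P1 ∩ P3) (P2 ∩ P3)
  have t6 : (P1 ∩ P3) ∩ (P2 ∩ P3) = P1 ∩ P2 ∩ P3 := by
    ext z; simp only [Finset.mem_inter]; clear * -; tauto
  have t7 : (P1 ∩ D ∪ P2 ∩ D ∪ P3 ∩ D).card ≤ D.card :=
    Finset.card_le_card (Finset.union_subset (Finset.union_subset Finset.inter_subset_right
      Finset.inter_subset_right) Finset.inter_subset_right)
  rw [t6] at t5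
  omega

open Classical in
lemma aux_ext {V : Type*} (G : SimpleGraph V) (g : V → Option (Finset ℕ))
    (hg : IsPartial2Tone8Coloring G g) (v : V) (L : Finset ℕ) (hc : IsCandidateLabel G g v L)
    (h2 : ∀ y, G.edist v y = 2 → g y ≠ some L) :
    IsExtensionAt G g (Function.update g v (some L)) v := by
  have core : ∀ u Lu, u ≠ v → g u = some Lu → ((L ∩ Lu).card : ℕ∞) < G.edist v u := by
    intro u Lu huv hu
    obtain ⟨hLc, hLs, hLd⟩ := hc
    have hLu := (hg.1 u Lu hu).1
    have hle : (L ∩ Lu).card ≤ 2 := hLc ▸ Finset.card_le_card Finset.inter_subset_left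
    cases hd : G.edist v u with
    | top => exact ENat.coe_lt_top _
    | coe n =>
      rw [Nat.cast_lt]
      by_contra hn
      have hn2 : n ≤ 2 := by omega
      interval_cases n
      · exact huv (SimpleGraph.edist_eq_zero_iff.1 hd).symm
      · have := hLd u Lu (SimpleGraph.edist_eq_one_iff_adj.1 (by simpa using hd)) hu
        rw [Finset.disjoint_iff_inter_eq_empty] at this
        simp [this] at hn
      · have e1 := Finset.eq_of_subset_of_card_le (Finset.inter_subset_left : L ∩ Lu ⊆ L) (by omega)
        have e2 := Finset.eq_of_subset_of_card_le (Finset.inter_subset_right : L ∩ Lu ⊆ Lu)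
          (by omega)
        exact h2 u hd (by rw [hu, ← e2, e1])
  refine ⟨⟨?_, ?_⟩, by simp, fun u hu => Function.update_of_ne hu _ _⟩
  · intro u M hM
    by_cases huv : u = v
    · subst huv
      simp at hM
      subst hM
      exact ⟨hc.1, hc.2.1⟩
    · rw [Function.update_of_ne huv] at hM
      exact hg.1 u M hM
  · intro a b La Lb hab ha hb
    by_cases hav : a = v
    · subst hav
      rw [Function.update_of_ne hab.symm] at hb
      simp at ha
      subst ha
      exact core b Lb hab.symm hb
    · rw [Function.update_of_ne hav] at ha
      by_cases hbv : b = v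
      · subst hbv
        simp at hb
        subst hb
        rw [SimpleGraph.edist_comm, Finset.inter_comm]
        exact core a La hav ha
      · rw [Function.update_of_ne hbv] at hb
        exact hg.2 a b La Lb hab ha hb

open Classical in
lemma aux_three {V : Type*} (G : SimpleGraph V) (f g : V → Option (Finset ℕ)) (v w₁ w₂ w₃ x : V)
    (hg : IsExtensionAt G f g w₁) (hN : ∀ u, G.Adj v u → u = w₁ ∨ u = w₂ ∨ u = w₃)
    (hw : G.Adj v w₁) (hw12 : w₁ ≠ w₂) (hw13 : w₃ ≠ w₁) (hf2 : f w₂ = none)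
    (A : Finset ℕ) (hA : g w₁ = some A) (D : Finset (Finset ℕ))
    (hD : ∀ y L, G.edist v y = 2 → y ≠ x → f y = some L → L ∈ D)
    (hx : ¬ YieldsObstruction G g v x)
    (hc : 2 < (Finset.powersetCard 2 (Finset.Icc 1 8 \ (A ∪ (f w₃).getD ∅)) \ D).card) :
    ∃ g₁ g₂ g₃, g₁ ≠ g₂ ∧ g₁ ≠ g₃ ∧ g₂ ≠ g₃ ∧
      IsExtensionAt G g g₁ v ∧ IsExtensionAt G g g₂ v ∧ IsExtensionAt G g g₃ v := by
  have main : ∀ L ∈ Finset.powersetCard 2 (Finset.Icc 1 8 \ (A ∪ (f w₃).getD ∅)) \ D,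
      IsExtensionAt G g (Function.update g v (some L)) v := by
    intro L hL
    rw [Finset.mem_sdiff, Finset.mem_powersetCard, Finset.subset_sdiff,
      Finset.disjoint_union_right] at hL
    obtain ⟨⟨⟨hLs, hLA, hLB⟩, hLc⟩, hLD⟩ := hL
    have hcand : IsCandidateLabel G g v L := by
      refine ⟨hLc, hLs, fun u Lu hu hgu => ?_⟩
      rcases hN u hu with rfl | rfl | rfl
      · rw [hA] at hgu
        cases hgu
        exact hLA
      · rw [hg.2.2 _ hw12.symm, hf2] at hgu
        cases hgu
      · rw [hg.2.2 _ hw13] at hgu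
        rw [hgu] at hLB
        exact hLB
    refine aux_ext G g hg.1 v L hcand fun y hy hyL => ?_
    by_cases hyx : y = x
    · subst hyx
      exact hx ⟨L, hyL, hcand⟩
    · refine hLD (hD y L hy hyx ?_)
      rw [← hg.2.2 y ?_, hyL]
      rintro rfl
      rw [SimpleGraph.edist_eq_one_iff_adj.2 hw] at hy
      exact absurd hy (by decide)
  obtain ⟨a, b, c, ha, hb, hc, hab, hac, hbc⟩ := Finset.two_lt_card_iff.1 hc
  have inj : ∀ L M : Finset ℕ, L ≠ M →
      Function.update g v (some L) ≠ Function.update g v (some M) := by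
    intro L M h he
    have := congrFun he v
    simp at this
    exact h this
  exact ⟨_, _, _, inj a b hab, inj a c hac, inj b c hbc, main a ha, main b hb, main c hc⟩

open Classical in
lemma aux_dist_s8 {V : Type*} [Fintype V] (G : SimpleGraph V) [DecidableRel G.Adj]
    (hreg : G.IsRegularOfDegree 3) (v : V) :
    (Finset.univ.filter fun y => G.edist v y = 2).card ≤ 6 := by
  have hsub : (Finset.univ.filter fun y => G.edist v y = 2) ⊆
      (G.neighborFinset v).biUnion fun w => (G.neighborFinset w).erase v := by
    intro y hy
    simp only [Finset.mem_filter, Finset.mem_univ, true_and] at hy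
    have hr : G.Reachable v y := SimpleGraph.edist_ne_top_iff_reachable.1 (by rw [hy]; decide)
    obtain ⟨p, hp⟩ := hr.exists_walk_length_eq_edist
    rw [hy] at hp
    have hp2 : p.length = 2 := by exact_mod_cast hp
    have hyv : y ≠ v := by
      rintro rfl
      rw [SimpleGraph.edist_self] at hy
      exact absurd hy (by decide)
    match p, hp2 with
    | .cons h1 (.cons h2 .nil), _ =>
      simp only [Finset.mem_biUnion, Finset.mem_erase, SimpleGraph.mem_neighborFinset]
      exact ⟨_, h1, hyv, h2⟩
  refine (Finset.card_le_card hsub).trans ?_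
  refine (Finset.card_biUnion_le_card_mul _ _ 2 ?_).trans ?_
  · intro w hw
    rw [Finset.card_erase_of_mem, SimpleGraph.card_neighborFinset_eq_degree, hreg w]
    rw [SimpleGraph.mem_neighborFinset] at hw ⊢
    exact hw.symm
  · rw [SimpleGraph.card_neighborFinset_eq_degree, hreg v]

theorem three_extensions_of_three_extensions
    {V : Type*} [Fintype V] (G : SimpleGraph V) [DecidableRel G.Adj]
    (hreg : G.IsRegularOfDegree 3)
    (v w₁ w₂ : V) (hw₁ : G.Adj v w₁) (hw₂ : G.Adj v w₂) (hww : w₁ ≠ w₂)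
    (f f₁ f₂ f₃ : V → Option (Finset ℕ)) (hf : IsPartial2Tone8Coloring G f)
    (hv : f v = none) (hfw₁ : f w₁ = none) (hfw₂ : f w₂ = none)
    (he₁ : IsExtensionAt G f f₁ w₁) (he₂ : IsExtensionAt G f f₂ w₁)
    (he₃ : IsExtensionAt G f f₃ w₁)
    (hne₁₂ : f₁ ≠ f₂) (hne₁₃ : f₁ ≠ f₃) (hne₂₃ : f₂ ≠ f₃)
    (hx : ∃ x : V, G.edist v x = 2 ∧ ¬ YieldsObstruction G f₁ v x ∧
      ¬ YieldsObstruction G f₂ v x ∧ ¬ YieldsObstruction G f₃ v x) :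
    (∃ g₁ g₂ g₃, g₁ ≠ g₂ ∧ g₁ ≠ g₃ ∧ g₂ ≠ g₃ ∧
      IsExtensionAt G f₁ g₁ v ∧ IsExtensionAt G f₁ g₂ v ∧ IsExtensionAt G f₁ g₃ v) ∨
    (∃ g₁ g₂ g₃, g₁ ≠ g₂ ∧ g₁ ≠ g₃ ∧ g₂ ≠ g₃ ∧
      IsExtensionAt G f₂ g₁ v ∧ IsExtensionAt G f₂ g₂ v ∧ IsExtensionAt G f₂ g₃ v) ∨
    (∃ g₁ g₂ g₃, g₁ ≠ g₂ ∧ g₁ ≠ g₃ ∧ g₂ ≠ g₃ ∧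
      IsExtensionAt G f₃ g₁ v ∧ IsExtensionAt G f₃ g₂ v ∧ IsExtensionAt G f₃ g₃ v) := by
  classical
  obtain ⟨x, hx2, hx⟩ := hx
  obtain ⟨w₃, hw₃⟩ : ∃ w, ((G.neighborFinset v).erase w₁).erase w₂ = {w} := by
    rw [← Finset.card_eq_one, Finset.card_erase_of_mem, Finset.card_erase_of_mem,
      SimpleGraph.card_neighborFinset_eq_degree, hreg v]
    · simpa using hw₁
    · simpa [hww.symm] using hw₂
  have hN : ∀ u, G.Adj v u → u = w₁ ∨ u = w₂ ∨ u = w₃ := by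
    intro u hu
    have := Finset.ext_iff.1 hw₃ u
    simp only [Finset.mem_erase, SimpleGraph.mem_neighborFinset, Finset.mem_singleton] at this
    tauto
  have hw31 : w₃ ≠ w₁ := by
    have := Finset.ext_iff.1 hw₃ w₃
    simp only [Finset.mem_erase, SimpleGraph.mem_neighborFinset, Finset.mem_singleton] at this
    tauto
  set D : Finset (Finset ℕ) :=
    ((Finset.univ.filter fun y => G.edist v y = 2).erase x).image fun y => (f y).getD ∅ with hDdef
  have hDc : D.card ≤ 5 := by
    refine Finset.card_image_le.trans ?_
    rw [Finset.card_erase_of_mem (by simpa using hx2)]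
    have := aux_dist_s8 G hreg v
    omega
  have hD : ∀ y L, G.edist v y = 2 → y ≠ x → f y = some L → L ∈ D := by
    intro y L hy hyx hL
    rw [hDdef, Finset.mem_image]
    exact ⟨y, by simp [hy, hyx], by simp [hL]⟩
  have hB : ((f w₃).getD ∅).card ≤ 2 ∧ (f w₃).getD ∅ ⊆ Finset.Icc 1 8 := by
    cases h : f w₃ with
    | none => simp
    | some L => exact ⟨(hf.1 _ _ h).1.le, (hf.1 _ _ h).2⟩
  obtain ⟨A₁, hA₁⟩ := Option.isSome_iff_exists.1 he₁.2.1
  obtain ⟨A₂, hA₂⟩ := Option.isSome_iff_exists.1 he₂.2.1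
  obtain ⟨A₃, hA₃⟩ := Option.isSome_iff_exists.1 he₃.2.1
  have neq : ∀ g g' : V → Option (Finset ℕ), ∀ A A', IsExtensionAt G f g w₁ →
      IsExtensionAt G f g' w₁ → g w₁ = some A → g' w₁ = some A' → g ≠ g' → A ≠ A' := by
    rintro g g' A _ hg hg' hA hA' hne rfl
    apply hne
    funext u
    by_cases hu : u = w₁
    · rw [hu, hA, hA']
    · rw [hg.2.2 u hu, hg'.2.2 u hu]
  have l1 := he₁.1.1 _ _ hA₁
  have l2 := he₂.1.1 _ _ hA₂
  have l3 := he₃.1.1 _ _ hA₃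
  rcases aux_comb (Finset.Icc 1 8) ((f w₃).getD ∅) A₁ A₂ A₃ D (by simp) hB.1 hB.2 l1.1 l2.1 l3.1
    l1.2 l2.2 l3.2 (neq _ _ _ _ he₁ he₂ hA₁ hA₂ hne₁₂) (neq _ _ _ _ he₁ he₃ hA₁ hA₃ hne₁₃)
    (neq _ _ _ _ he₂ he₃ hA₂ hA₃ hne₂₃) hDc with h | h | h
  · exact Or.inl (aux_three G f f₁ v w₁ w₂ w₃ x he₁ hN hw₁ hww hw31 hfw₂ A₁ hA₁ D hD hx.1 h)
  · exact Or.inr (Or.inl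
      (aux_three G f f₂ v w₁ w₂ w₃ x he₂ hN hw₁ hww hw31 hfw₂ A₂ hA₂ D hD hx.2.1 h))
  · exact Or.inr (Or.inr
      (aux_three G f f₃ v w₁ w₂ w₃ x he₃ hN hw₁ hww hw31 hfw₂ A₃ hA₃ D hD hx.2.2 h))
end

section
/- Let G be a finite simple 3-regular graph, let v be a vertex of G with neighbors w₁, w₂, w₃, and let x be a vertex at distance exactly 2 from v. Let f be a partial 2-tone 8-coloring of G under which v and w₁ are uncolored while w₂, w₃, and x are colored, and suppose the label of w₂ shares a color with the label of w₃ and also shares a color with the label of x. If f has at least three distinct extensions to w₁, then one of these extensions can itself be extended to v. -/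
open Finset in
theorem tt_pairs (A P Q : Finset ℕ) (hA : #A = 5) (hP : #P = 2) (hQ : #Q = 2)
    (hPA : P ⊆ A) (hQA : Q ⊆ A) (hne : P ≠ Q) :
    #(powersetCard 2 (A \ P) ∩ powersetCard 2 (A \ Q)) ≤ 1 := by
  have h1 : powersetCard 2 (A \ P) ∩ powersetCard 2 (A \ Q) ⊆ powersetCard 2 (A \ (P ∪ Q)) := by
    intro S
    simp only [mem_inter, mem_powersetCard]
    rintro ⟨⟨h, hc⟩, h', -⟩
    refine ⟨?_, hc⟩
    intro a ha
    have := h ha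
    have := h' ha
    simp_all
  refine (card_le_card h1).trans ?_
  rw [card_powersetCard, card_sdiff_of_subset (union_subset hPA hQA), hA]
  have h3 : 3 ≤ #(P ∪ Q) := by
    by_contra h
    have e1 := eq_of_subset_of_card_le (subset_union_left (s₁ := P) (s₂ := Q)) (by omega)
    have e2 := eq_of_subset_of_card_le (subset_union_right (s₁ := P) (s₂ := Q)) (by omega)
    exact hne (e1.trans e2.symm)
  calc (5 - #(P ∪ Q)).choose 2 ≤ Nat.choose 2 2 := Nat.choose_le_choose 2 (by omega)
    _ = 1 := by decide

open Finset in
theorem tt_choice (A P Q R : Finset ℕ) (F : Finset (Finset ℕ)) (hF : #F ≤ 5)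
    (hA : #A = 5) (hP : #P = 2) (hQ : #Q = 2) (hR : #R = 2)
    (hPQ : P ≠ Q) (hPR : P ≠ R) (hQR : Q ≠ R) :
    ∃ L, L ∉ F ∧ #L = 2 ∧ (L ⊆ A \ P ∨ L ⊆ A \ Q ∨ L ⊆ A \ R) := by
  have key : ∀ W : Finset ℕ, #W = 2 → ¬ W ⊆ A → ∃ L, L ∉ F ∧ #L = 2 ∧ L ⊆ A \ W := by
    intro W hW hWA
    have h1 : #(W ∩ A) < 2 := by
      rw [← hW]
      apply card_lt_card
      refine ⟨inter_subset_left, fun h => hWA (h.trans inter_subset_right)⟩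
    have h2 : 4 ≤ #(A \ W) := by
      rw [card_sdiff]; omega
    have h3 : 6 ≤ #(powersetCard 2 (A \ W)) := by
      rw [card_powersetCard]
      calc 6 = Nat.choose 4 2 := by decide
        _ ≤ _ := Nat.choose_le_choose 2 h2
    obtain ⟨L, hL, hLF⟩ := exists_mem_notMem_of_card_lt_card (s := F) (t := powersetCard 2 (A \ W)) (by omega)
    rw [mem_powersetCard] at hL
    exact ⟨L, hLF, hL.2, hL.1⟩
  by_cases hPA : P ⊆ A
  swap
  · obtain ⟨L, a, b, c⟩ := key P hP hPA
    exact ⟨L, a, b, Or.inl c⟩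
  by_cases hQA : Q ⊆ A
  swap
  · obtain ⟨L, a, b, c⟩ := key Q hQ hQA
    exact ⟨L, a, b, Or.inr (Or.inl c)⟩
  by_cases hRA : R ⊆ A
  swap
  · obtain ⟨L, a, b, c⟩ := key R hR hRA
    exact ⟨L, a, b, Or.inr (Or.inr c)⟩
  have i1 := tt_pairs A P Q hA hP hQ hPA hQA hPQ
  have i2 := tt_pairs A P R hA hP hR hPA hRA hPR
  have i3 := tt_pairs A Q R hA hQ hR hQA hRA hQR
  have c3 : ∀ W : Finset ℕ, #W = 2 → W ⊆ A → #(powersetCard 2 (A \ W)) = 3 := by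
    intro W hW hWA
    rw [card_powersetCard, card_sdiff_of_subset hWA, hA, hW]; decide
  have cP := c3 P hP hPA
  have cQ := c3 Q hQ hQA
  have cR := c3 R hR hRA
  have u1 := card_union_add_card_inter (powersetCard 2 (A \ P)) (powersetCard 2 (A \ Q))
  have u2 := card_union_add_card_inter (powersetCard 2 (A \ P) ∪ powersetCard 2 (A \ Q))
    (powersetCard 2 (A \ R))
  rw [union_inter_distrib_right] at u2
  have u3 := card_union_le (powersetCard 2 (A \ P) ∩ powersetCard 2 (A \ R))
    (powersetCard 2 (A \ Q) ∩ powersetCard 2 (A \ R))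
  obtain ⟨L, hL, hLF⟩ := exists_mem_notMem_of_card_lt_card (s := F)
    (t := powersetCard 2 (A \ P) ∪ powersetCard 2 (A \ Q) ∪ powersetCard 2 (A \ R)) (by omega)
  simp only [mem_union, mem_powersetCard] at hL
  exact ⟨L, hLF, by tauto, by tauto⟩

theorem tt_common {V : Type*} (G : SimpleGraph V) (v u : V) (h : G.edist v u = 2) :
    ∃ w, G.Adj v w ∧ G.Adj w u := by
  have hr : G.Reachable v u := by
    rw [← SimpleGraph.edist_ne_top_iff_reachable, h]; decide
  obtain ⟨p, hp⟩ := hr.exists_walk_length_eq_edist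
  rw [h] at hp
  have hp : p.length = 2 := by exact_mod_cast hp
  match p, hp with
  | .cons a (.cons b .nil), _ => exact ⟨_, a, b⟩

open Finset in
theorem tt_ball {V : Type*} [Fintype V] (G : SimpleGraph V) [DecidableRel G.Adj]
    (hreg : G.IsRegularOfDegree 3) (v : V) (D : Finset V) (hD : ∀ u ∈ D, G.edist v u = 2) :
    #D ≤ 6 := by
  classical
  have hs : D ⊆ (G.neighborFinset v).biUnion (fun w => (G.neighborFinset w).erase v) := by
    intro u hu
    have h2 := hD u hu
    obtain ⟨w, h, h'⟩ := tt_common G v u h2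
    simp only [mem_biUnion, mem_erase, SimpleGraph.mem_neighborFinset]
    refine ⟨w, h, ?_, h'⟩
    rintro rfl
    simp at h2
  refine (card_le_card hs).trans ?_
  refine (card_biUnion_le_card_mul _ _ 2 ?_).trans ?_
  · intro w hw
    rw [SimpleGraph.mem_neighborFinset] at hw
    rw [card_erase_of_mem (by simpa using hw.symm), SimpleGraph.card_neighborFinset_eq_degree,
      hreg w]
  · rw [SimpleGraph.card_neighborFinset_eq_degree, hreg v]

open Finset in
theorem tt_ext {V : Type*} (G : SimpleGraph V) (g : V → Option (Finset ℕ)) (v : V)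
    (hg : IsPartial2Tone8Coloring G g) (L : Finset ℕ) (hL : #L = 2) (hL8 : L ⊆ Icc 1 8)
    (hadj : ∀ u M, G.Adj v u → g u = some M → Disjoint L M)
    (hd2 : ∀ u M, G.edist v u = 2 → g u = some M → L ≠ M) :
    ∃ h, IsExtensionAt G g h v := by
  classical
  have main : ∀ u M, v ≠ u → g u = some M → ((#(L ∩ M) : ℕ) : ℕ∞) < G.edist v u := by
    intro u M hne hu
    have hle : #(L ∩ M) ≤ 2 := hL ▸ card_le_card inter_subset_left
    have hM := (hg.1 u M hu).1
    by_cases h1 : G.Adj v u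
    · have := hadj u M h1 hu
      rw [disjoint_iff_inter_eq_empty] at this
      rw [this]
      simpa using SimpleGraph.edist_pos_of_ne hne
    by_cases h2 : G.edist v u = 2
    · rw [h2]
      have : #(L ∩ M) ≠ 2 := by
        intro hc
        have e1 := eq_of_subset_of_card_le (inter_subset_left (s₁ := L) (s₂ := M)) (by omega)
        have e2 := eq_of_subset_of_card_le (inter_subset_right (s₁ := L) (s₂ := M)) (by omega)
        exact hd2 u M h2 hu (e1.symm.trans e2)
      have : #(L ∩ M) < 2 := by omega
      exact_mod_cast this
    · have h0 : G.edist v u ≠ 0 := by simpa using hne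
      have h1' : G.edist v u ≠ 1 := by rwa [Ne, SimpleGraph.edist_eq_one_iff_adj]
      generalize G.edist v u = d at *
      cases d with
      | top => exact WithTop.coe_lt_top _
      | coe d =>
        norm_cast at *
        omega
  refine ⟨Function.update g v (some L), ⟨?_, ?_⟩, by simp, ?_⟩
  · intro u M hu
    by_cases h : u = v
    · subst h
      simp at hu
      subst hu
      exact ⟨hL, hL8⟩
    · rw [Function.update_of_ne h] at hu
      exact hg.1 u M hu
  · intro a b La Lb hab ha hb
    by_cases h : a = v
    · subst h
      simp at ha
      subst ha
      rw [Function.update_of_ne hab.symm] at hb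
      exact main b Lb hab hb
    rw [Function.update_of_ne h] at ha
    by_cases h' : b = v
    · subst h'
      simp at hb
      subst hb
      rw [inter_comm, SimpleGraph.edist_comm]
      exact main a La hab.symm ha
    rw [Function.update_of_ne h'] at hb
    exact hg.2 a b La Lb hab ha hb
  · intro u hu
    exact Function.update_of_ne hu _ _

theorem finish_coloring_from_three_extensions
    {V : Type*} [Fintype V] (G : SimpleGraph V) [DecidableRel G.Adj]
    (hreg : G.IsRegularOfDegree 3)
    (v w₁ w₂ w₃ x : V)
    (hw₁ : G.Adj v w₁) (hw₂ : G.Adj v w₂) (hw₃ : G.Adj v w₃)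
    (h₁₂ : w₁ ≠ w₂) (h₁₃ : w₁ ≠ w₃) (h₂₃ : w₂ ≠ w₃)
    (hx : G.edist v x = 2)
    (f : V → Option (Finset ℕ)) (hf : IsPartial2Tone8Coloring G f)
    (hv : f v = none) (hfw₁ : f w₁ = none)
    (L₂ L₃ Lx : Finset ℕ) (hL₂ : f w₂ = some L₂) (hL₃ : f w₃ = some L₃)
    (hLx : f x = some Lx)
    (hshare₂₃ : (L₂ ∩ L₃).Nonempty) (hshare₂ₓ : (L₂ ∩ Lx).Nonempty)
    (g₁ g₂ g₃ : V → Option (Finset ℕ))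
    (hg₁ : IsExtensionAt G f g₁ w₁) (hg₂ : IsExtensionAt G f g₂ w₁)
    (hg₃ : IsExtensionAt G f g₃ w₁)
    (hne₁₂ : g₁ ≠ g₂) (hne₁₃ : g₁ ≠ g₃) (hne₂₃ : g₂ ≠ g₃) :
    (∃ h, IsExtensionAt G g₁ h v) ∨ (∃ h, IsExtensionAt G g₂ h v) ∨
      (∃ h, IsExtensionAt G g₃ h v) := by
  classical
  have hnb : G.neighborFinset v = {w₁, w₂, w₃} := by
    symm
    apply Finset.eq_of_subset_of_card_le
    · intro u
      simp only [Finset.mem_insert, Finset.mem_singleton, SimpleGraph.mem_neighborFinset]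
      rintro (rfl | rfl | rfl) <;> assumption
    · rw [SimpleGraph.card_neighborFinset_eq_degree, hreg v, Finset.card_eq_three.2
        ⟨w₁, w₂, w₃, h₁₂, h₁₃, h₂₃, rfl⟩]
  obtain ⟨c2, s2⟩ := hf.1 _ _ hL₂
  obtain ⟨c3, s3⟩ := hf.1 _ _ hL₃
  have hi : (L₂ ∩ L₃).card = 1 := by
    have h := hf.2 _ _ _ _ h₂₃ hL₂ hL₃
    have hle : G.edist w₂ w₃ ≤ 2 :=
      (SimpleGraph.Walk.edist_le (.cons hw₂.symm (.cons hw₃ .nil)))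
    have h' : (((L₂ ∩ L₃).card : ℕ) : ℕ∞) < (2 : ℕ) := lt_of_lt_of_le h hle
    have h' : (L₂ ∩ L₃).card < 2 := by exact_mod_cast h'
    have := hshare₂₃.card_pos
    omega
  have hU : (L₂ ∪ L₃).card = 3 := by
    have := Finset.card_union_add_card_inter L₂ L₃
    omega
  have hA : (Finset.Icc 1 8 \ (L₂ ∪ L₃)).card = 5 := by
    rw [Finset.card_sdiff_of_subset (Finset.union_subset s2 s3), hU]; simp
  have hxD : x ∈ (Finset.univ.filter fun u => G.edist v u = 2) := by simpa using hx
  have hball := tt_ball G hreg v (Finset.univ.filter fun u => G.edist v u = 2) (by simp)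
  have hF : (((Finset.univ.filter fun u => G.edist v u = 2).erase x).image
      fun u => (f u).getD ∅).card ≤ 5 := by
    refine Finset.card_image_le.trans ?_
    rw [Finset.card_erase_of_mem hxD]; omega
  have fin : ∀ g P L, IsExtensionAt G f g w₁ → g w₁ = some P →
      L ∉ (((Finset.univ.filter fun u => G.edist v u = 2).erase x).image
        fun u => (f u).getD ∅) → L.card = 2 → L ⊆ (Finset.Icc 1 8 \ (L₂ ∪ L₃)) \ P →
      ∃ h, IsExtensionAt G g h v := by
    intro g P L hg hP hLF hLc hL
    refine tt_ext G g v hg.1 L hLc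
      (hL.trans (Finset.sdiff_subset.trans Finset.sdiff_subset)) ?_ ?_
    · intro u M hu hM
      rw [← SimpleGraph.mem_neighborFinset, hnb] at hu
      simp only [Finset.mem_insert, Finset.mem_singleton] at hu
      rw [Finset.disjoint_left]
      intro a ha haM
      have haL := hL ha
      simp only [Finset.mem_sdiff, Finset.mem_union, not_or] at haL
      rcases hu with rfl | rfl | rfl
      · rw [hP] at hM
        cases hM
        exact haL.2 haM
      · rw [hg.2.2 _ h₁₂.symm, hL₂] at hM
        cases hM
        exact haL.1.2.1 haM
      · rw [hg.2.2 _ h₁₃.symm, hL₃] at hM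
        cases hM
        exact haL.1.2.2 haM
    · intro u M hu hM hLM
      subst hLM
      have huw : u ≠ w₁ := by
        rintro rfl
        rw [SimpleGraph.edist_eq_one_iff_adj.2 hw₁] at hu
        exact absurd hu (by decide)
      rw [hg.2.2 _ huw] at hM
      by_cases hux : u = x
      · subst hux
        rw [hLx] at hM
        cases hM
        obtain ⟨a, ha⟩ := hshare₂ₓ
        rw [Finset.mem_inter] at ha
        have haL := hL ha.2
        simp only [Finset.mem_sdiff, Finset.mem_union, not_or] at haL
        exact haL.1.2.1 ha.1
      · apply hLF
        rw [Finset.mem_image]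
        exact ⟨u, by simp [hux, hu], by simp [hM]⟩
  have hdiff : ∀ g g' P Q, IsExtensionAt G f g w₁ → IsExtensionAt G f g' w₁ →
      g w₁ = some P → g' w₁ = some Q → g ≠ g' → P ≠ Q := by
    rintro g g' P Q hg hg' hP hQ hne rfl
    apply hne
    funext u
    by_cases h : u = w₁
    · rw [h, hP, hQ]
    · rw [hg.2.2 u h, hg'.2.2 u h]
  obtain ⟨P, hP⟩ := Option.isSome_iff_exists.1 hg₁.2.1
  obtain ⟨Q, hQ⟩ := Option.isSome_iff_exists.1 hg₂.2.1
  obtain ⟨R, hR⟩ := Option.isSome_iff_exists.1 hg₃.2.1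
  obtain ⟨L, hLF, hLc, h⟩ := tt_choice _ P Q R _ hF hA (hg₁.1.1 _ _ hP).1 (hg₂.1.1 _ _ hQ).1
    (hg₃.1.1 _ _ hR).1 (hdiff _ _ _ _ hg₁ hg₂ hP hQ hne₁₂) (hdiff _ _ _ _ hg₁ hg₃ hP hR hne₁₃)
    (hdiff _ _ _ _ hg₂ hg₃ hQ hR hne₂₃)
  rcases h with h | h | h
  · exact Or.inl (fin _ _ L hg₁ hP hLF hLc h)
  · exact Or.inr (Or.inl (fin _ _ L hg₂ hQ hLF hLc h))
  · exact Or.inr (Or.inr (fin _ _ L hg₃ hR hLF hLc h))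
end
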